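/- arXiv:1401.2780 — 7 statements merged into one kernel-verified Lean document; each statement's English description precedes it below -/
import Mathlib

section
/- Let M and N be measurable spaces and let ·* be a map sending Borel (measurable) subsets of M to measurable subsets of N that satisfies: (a) ∅* = ∅ and M* = N; (b) monotonicity: if A ⊆ B are measurable sets then A* ⊆ B*; (c) continuity from the inside: if (A_n) is an increasing sequence of measurable subsets of M, then (⋃_n A_n)* = ⋃_n (A_n)*. Then the function u* : N → ℝ̄ defined for every y ∈ N by u*(y) = sup{ t ∈ ℝ : y ∈ {x ∈ M : u(x) > t}* } satisfies, for every measurable u : M → ℝ̄ and every t ∈ ℝ, {y ∈ N : u*(y) > t} = {x ∈ M : u(x) > t}*. -/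
open Set Filter Topology

/-- A strict superlevel set at a real level is the union of the superlevel sets at the levels
`t + 1 / (n + 1)`. -/
theorem iUnion_superlevel_add_one_div {M : Type*} (u : M → EReal) (t : ℝ) :
    ⋃ n : ℕ, {x : M | ((t + 1 / ((n : ℝ) + 1) : ℝ) : EReal) < u x}
      = {x : M | (t : EReal) < u x} := by
  ext x
  simp only [mem_iUnion, mem_ofPred_eq]
  constructor
  · rintro ⟨n, hn⟩
    refine lt_trans (EReal.coe_lt_coe_iff.2 ?_) hn
    have : (0 : ℝ) < 1 / ((n : ℝ) + 1) := Nat.one_div_pos_of_nat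
    linarith
  · intro hx
    obtain ⟨r, htr, hru⟩ := EReal.lt_iff_exists_real_btwn.1 hx
    obtain ⟨n, hn⟩ := exists_nat_one_div_lt (sub_pos.2 (EReal.coe_lt_coe_iff.1 htr))
    exact ⟨n, lt_trans (EReal.coe_lt_coe_iff.2 (by linarith)) hru⟩

/-- A monotone transformation of measurable sets mapping `∅` to `∅` and `M` to
`N`, which is continuous from the inside, induces a transformation of functions acting on level
sets via `u*(y) = sup { t ∈ ℝ : y ∈ {x : u x > t}* }`. -/
theorem statement3 {M N : Type*} [MeasurableSpace M] [MeasurableSpace N]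
    (T : Set M → Set N)
    (hTmeas : ∀ A : Set M, MeasurableSet A → MeasurableSet (T A))
    (hempty : T ∅ = ∅) (huniv : T univ = univ)
    (hmono : ∀ A B : Set M, MeasurableSet A → MeasurableSet B → A ⊆ B → T A ⊆ T B)
    (hcont : ∀ A : ℕ → Set M, (∀ k, MeasurableSet (A k)) → Monotone A →
      T (⋃ k, A k) = ⋃ k, T (A k))
    (u : M → EReal) (hu : Measurable u) (t : ℝ) :
    {y : N | (t : EReal) <
        sSup {s : EReal | ∃ r : ℝ, s = (r : EReal) ∧ y ∈ T {x : M | (r : EReal) < u x}}}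
      = T {x : M | (t : EReal) < u x} := by
  have hmeas (r : ℝ) : MeasurableSet {x : M | (r : EReal) < u x} :=
    measurableSet_lt measurable_const hu
  have hanti {r s : ℝ} (hrs : r ≤ s) :
      {x : M | (s : EReal) < u x} ⊆ {x : M | (r : EReal) < u x} :=
    fun _ hx => lt_of_le_of_lt (EReal.coe_le_coe_iff.2 hrs) hx
  ext y
  rw [mem_ofPred_eq, lt_sSup_iff]
  constructor
  · rintro ⟨_, ⟨r, rfl, hy⟩, htr⟩
    exact hmono _ _ (hmeas r) (hmeas t) (hanti (EReal.coe_lt_coe_iff.1 htr).le) hy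
  · intro hy
    rw [← iUnion_superlevel_add_one_div u t, hcont _ (fun n => hmeas _)
      (fun m n hmn => hanti (by gcongr)), mem_iUnion] at hy
    obtain ⟨n, hn⟩ := hy
    refine ⟨_, ⟨_, rfl, hn⟩, EReal.coe_lt_coe_iff.2 ?_⟩
    have : (0 : ℝ) < 1 / ((n : ℝ) + 1) := Nat.one_div_pos_of_nat
    linarith
end

section
/- Let M and N be measurable spaces and let ·* be a map sending measurable subsets of M to measurable subsets of N that induces a transformation of functions acting on level sets. Then ·* is monotone (if A ⊆ B are measurable sets then A* ⊆ B*) and continuous from the inside (if (A_n) is an increasing sequence of measurable subsets of M, then (⋃_n A_n)* = ⋃_n (A_n)*). -/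
open Set Filter Topology

/-- A function whose superlevel sets encode an increasing sequence of sets: the function equal to
`1 / (k + 1)` on the points entering the sequence at index `k`, and `0` outside the union. -/
noncomputable def entryLevel {M : Type*} (A : ℕ → Set M) (x : M) : EReal :=
  ⨆ k, (A k).indicator (fun _ => ((1 / ((k : ℝ) + 1) : ℝ) : EReal)) x

theorem measurable_entryLevel {M : Type*} [MeasurableSpace M] {A : ℕ → Set M}
    (hA : ∀ k, MeasurableSet (A k)) : Measurable (entryLevel A) :=
  Measurable.iSup fun k => measurable_const.indicator (hA k)

theorem coe_lt_entryLevel_iff {M : Type*} (A : ℕ → Set M) {t : ℝ} (ht : 0 ≤ t) (x : M) :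
    (t : EReal) < entryLevel A x ↔ ∃ k, x ∈ A k ∧ t < 1 / ((k : ℝ) + 1) := by
  rw [entryLevel, lt_iSup_iff]
  refine exists_congr fun k => ?_
  by_cases hx : x ∈ A k
  · rw [indicator_of_mem hx, EReal.coe_lt_coe_iff]
    simp only [hx, true_and]
  · rw [indicator_of_notMem hx]
    simp only [hx, false_and, iff_false, not_lt]
    exact_mod_cast ht

theorem setOf_zero_lt_entryLevel {M : Type*} (A : ℕ → Set M) :
    {x | ((0 : ℝ) : EReal) < entryLevel A x} = ⋃ k, A k := by
  ext x
  rw [mem_ofPred_eq, coe_lt_entryLevel_iff A le_rfl, mem_iUnion]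
  exact exists_congr fun k => and_iff_left (by positivity)

theorem setOf_one_div_lt_entryLevel {M : Type*} {A : ℕ → Set M} (hA : Monotone A) (k : ℕ) :
    {x | ((1 / ((k : ℝ) + 2) : ℝ) : EReal) < entryLevel A x} = A k := by
  ext x
  rw [mem_ofPred_eq, coe_lt_entryLevel_iff A (by positivity)]
  constructor
  · rintro ⟨j, hj, hlt⟩
    have h : (j : ℝ) + 1 < k + 2 := lt_of_one_div_lt_one_div (by positivity) hlt
    have hjk : j < k + 1 := by
      have : (j : ℝ) < k + 1 := by linarith
      exact_mod_cast this
    exact hA (Nat.lt_succ_iff.mp hjk) hj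
  · exact fun hx => ⟨k, hx, one_div_lt_one_div_of_lt (by positivity) (by linarith)⟩

theorem EReal.zero_lt_iff_exists_one_div_lt (v : EReal) :
    ((0 : ℝ) : EReal) < v ↔ ∃ k : ℕ, ((1 / ((k : ℝ) + 2) : ℝ) : EReal) < v := by
  constructor
  · intro h
    obtain ⟨r, hr, hrv⟩ := EReal.lt_iff_exists_real_btwn.mp h
    obtain ⟨k, hk⟩ := exists_nat_one_div_lt (EReal.coe_lt_coe_iff.mp hr)
    refine ⟨k, lt_trans (EReal.coe_lt_coe_iff.mpr (lt_trans ?_ hk)) hrv⟩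
    exact one_div_lt_one_div_of_lt (by positivity) (by linarith)
  · rintro ⟨k, hk⟩
    exact lt_trans (EReal.coe_lt_coe_iff.mpr (by positivity)) hk

/-- A transformation of measurable sets that induces a transformation of
functions acting on level sets is monotone and continuous from the inside. -/
theorem statement4 {M N : Type*} [MeasurableSpace M] [MeasurableSpace N]
    (T : Set M → Set N) (F : (M → EReal) → N → EReal)
    (hTmeas : ∀ A : Set M, MeasurableSet A → MeasurableSet (T A))
    (hempty : T ∅ = ∅) (huniv : T univ = univ)
    (hFmeas : ∀ u : M → EReal, Measurable u → Measurable (F u))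
    (hlevel : ∀ u : M → EReal, Measurable u → ∀ t : ℝ,
      {y : N | (t : EReal) < F u y} = T {x : M | (t : EReal) < u x}) :
    (∀ A B : Set M, MeasurableSet A → MeasurableSet B → A ⊆ B → T A ⊆ T B) ∧
    (∀ A : ℕ → Set M, (∀ k, MeasurableSet (A k)) → Monotone A →
      T (⋃ k, A k) = ⋃ k, T (A k)) := by
  have hcont : ∀ A : ℕ → Set M, (∀ k, MeasurableSet (A k)) → Monotone A →
      T (⋃ k, A k) = ⋃ k, T (A k) := by
    intro A hA hmono
    have hlev := hlevel (entryLevel A) (measurable_entryLevel hA)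
    rw [← setOf_zero_lt_entryLevel A, ← hlev 0]
    ext y
    rw [mem_ofPred_eq, EReal.zero_lt_iff_exists_one_div_lt, mem_iUnion]
    refine exists_congr fun k => ?_
    rw [← setOf_one_div_lt_entryLevel hmono k, ← hlev, mem_ofPred_eq]
  refine ⟨fun A B hA hB hAB => ?_, hcont⟩
  let S : ℕ → Set M := fun k => if k = 0 then A else B
  have hS : ∀ k, MeasurableSet (S k) := fun k => by
    by_cases hk : k = 0 <;> simp [S, hk, hA, hB]
  have hSmono : Monotone S := monotone_nat_of_le_succ fun k => by
    by_cases hk : k = 0 <;> simp [S, hk, hAB]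
  have hSB : ⋃ k, S k = B := by
    refine Subset.antisymm (iUnion_subset fun k => ?_) (subset_iUnion S 1)
    by_cases hk : k = 0 <;> simp [S, hk, hAB]
  calc T A ⊆ ⋃ k, T (S k) := subset_iUnion (fun k => T (S k)) 0
    _ = T B := by rw [← hcont S hS hSmono, hSB]
end

section
/- Let M and N be measurable spaces and let ·* be a transformation mapping measurable functions u : M → ℝ̄ to measurable functions u* : N → ℝ̄ satisfying: (a) 0* = 0; (b) monotonicity: if u ≤ v on M then u* ≤ v*; (c) continuity: for every nondecreasing sequence of measurable functions (u_n), the sequence (u_n*) converges pointwise to (lim_{n→∞} u_n)*; (d) commutation with composition: for every nondecreasing continuous f : ℝ̄ → ℝ̄ and every measurable u, f ∘ (u*) = (f ∘ u)*. Then there is a transformation of measurable sets A ↦ A* (defined by χ_{A*} = (χ_A)*) such that for every measurable u : M → ℝ̄ and every t ∈ ℝ, {y ∈ N : u*(y) > t} = {x ∈ M : u(x) > t}*. -/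
open Set Filter Topology

/-- Given a real `t`, there is a continuous nondecreasing function on `EReal` with nonnegative real
values which is positive exactly on `Ioi t`. -/
lemma EReal.exists_continuous_monotone_pos_iff (t : ℝ) :
    ∃ r : EReal → ℝ, Continuous r ∧ Monotone r ∧ (∀ s, 0 ≤ r s) ∧
      ∀ s, 0 < r s ↔ (t : EReal) < s := by
  set c : EReal → EReal := fun s => max (t : EReal) (min s ((t + 1 : ℝ) : EReal)) with hc
  have hcont : Continuous c := by fun_prop
  have hmono : Monotone c := fun a b h => max_le_max le_rfl (min_le_min h le_rfl)
  have hlower : ∀ s, (t : EReal) ≤ c s := fun s => le_max_left _ _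
  have hupper : ∀ s, c s ≤ ((t + 1 : ℝ) : EReal) := fun s =>
    max_le (EReal.coe_le_coe_iff.2 (by linarith)) (min_le_right _ _)
  have hbot : ∀ s, c s ≠ ⊥ := fun s => ((EReal.bot_lt_coe t).trans_le (hlower s)).ne'
  have htop : ∀ s, c s ≠ ⊤ := fun s => ((hupper s).trans_lt (EReal.coe_lt_top _)).ne
  have hcoe : ∀ s, ((c s).toReal : EReal) = c s := fun s => EReal.coe_toReal (htop s) (hbot s)
  refine ⟨fun s => (c s).toReal - t, ?_, ?_, ?_, ?_⟩
  · refine Continuous.sub (EReal.continuousOn_toReal.comp_continuous hcont fun s => ?_)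
      continuous_const
    simp [hbot s, htop s]
  · intro a b h
    exact sub_le_sub_right (EReal.toReal_le_toReal (hmono h) (hbot a) (htop b)) t
  · intro s
    rw [_root_.sub_nonneg, ← EReal.coe_le_coe_iff, hcoe]
    exact hlower s
  · intro s
    rw [_root_.sub_pos, ← EReal.coe_lt_coe_iff, hcoe]
    have ht : (t : EReal) < ((t + 1 : ℝ) : EReal) := EReal.coe_lt_coe_iff.2 (by linarith)
    simp only [hc, lt_max_iff, lt_self_iff_false, false_or, lt_min_iff, ht, and_true]

/-- The indicator function of `Ioi t` on `EReal` is the supremum of a nondecreasing sequence of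
continuous nondecreasing functions. -/
lemma EReal.exists_seq_continuous_monotone_iSup_eq_indicator_Ioi (t : ℝ) :
    ∃ f : ℕ → EReal → EReal, (∀ n, Continuous (f n)) ∧ (∀ n, Monotone (f n)) ∧
      (∀ s, Monotone fun n => f n s) ∧
      ∀ s, ⨆ n, f n s = (Ioi (t : EReal)).indicator (fun _ => 1) s := by
  obtain ⟨r, hr, hr_mono, hr_nonneg, hr_pos⟩ := EReal.exists_continuous_monotone_pos_iff t
  refine ⟨fun n s => ((min (n * r s) 1 : ℝ) : EReal), ?_, ?_, ?_, ?_⟩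
  · intro n
    exact continuous_coe_real_ereal.comp (by fun_prop)
  · intro n a b h
    exact EReal.coe_le_coe_iff.2
      (min_le_min (mul_le_mul_of_nonneg_left (hr_mono h) n.cast_nonneg) le_rfl)
  · intro s m n h
    exact EReal.coe_le_coe_iff.2
      (min_le_min (mul_le_mul_of_nonneg_right (Nat.cast_le.2 h) (hr_nonneg s)) le_rfl)
  · intro s
    by_cases hs : (t : EReal) < s
    · rw [indicator_of_mem (mem_Ioi.2 hs)]
      refine le_antisymm (iSup_le fun n => EReal.coe_le_coe_iff.2 (min_le_right _ _)) ?_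
      obtain ⟨n, hn⟩ := exists_nat_ge (1 / r s)
      refine le_iSup_of_le n ?_
      rw [div_le_iff₀ ((hr_pos s).2 hs)] at hn
      exact EReal.coe_le_coe_iff.2 (le_min hn le_rfl)
    · rw [indicator_of_notMem (by simpa using hs)]
      have h0 : r s = 0 := le_antisymm (not_lt.1 fun h => hs ((hr_pos s).1 h)) (hr_nonneg s)
      simp [h0]

/-- A transformation which is continuous along nondecreasing sequences and commutes with
composition with continuous nondecreasing maps commutes with taking indicators of strict
superlevel sets. -/
lemma indicator_superlevel_of_comp_of_tendsto {M N : Type*} [MeasurableSpace M]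
    (F : (M → EReal) → N → EReal)
    (hcont : ∀ u : ℕ → M → EReal, (∀ k, Measurable (u k)) →
      (∀ x : M, Monotone fun k => u k x) →
      ∀ y, Tendsto (fun k => F (u k) y) atTop (nhds (F (fun x => ⨆ k, u k x) y)))
    (hcomp : ∀ f : EReal → EReal, Continuous f → Monotone f →
      ∀ u : M → EReal, Measurable u → F (f ∘ u) = f ∘ F u)
    {u : M → EReal} (hu : Measurable u) (t : ℝ) :
    F ({x | (t : EReal) < u x}.indicator fun _ => 1) =
      {y | (t : EReal) < F u y}.indicator fun _ => 1 := by
  obtain ⟨f, hf, hf_mono, hf_seq, hf_iSup⟩ :=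
    EReal.exists_seq_continuous_monotone_iSup_eq_indicator_Ioi t
  funext y
  have h := hcont (fun n => f n ∘ u) (fun n => (hf n).measurable.comp hu)
    (fun x => hf_seq (u x)) y
  simp only [hcomp _ (hf _) (hf_mono _) u hu, Function.comp_apply, hf_iSup] at h
  have h' := tendsto_atTop_iSup (hf_seq (F u y))
  rw [hf_iSup] at h'
  exact tendsto_nhds_unique h h'

/-- A transformation of measurable functions mapping `0` to `0` which is
monotone, continuous along nondecreasing sequences and commutes with composition with continuous
nondecreasing maps is induced by a transformation of measurable sets acting on level sets. -/
theorem statement5 {M N : Type*} [MeasurableSpace M] [MeasurableSpace N]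
    (F : (M → EReal) → N → EReal)
    (hFmeas : ∀ u : M → EReal, Measurable u → Measurable (F u))
    (hzero : F (fun _ => 0) = fun _ => 0)
    (hmono : ∀ u v : M → EReal, Measurable u → Measurable v → (∀ x, u x ≤ v x) →
      ∀ y, F u y ≤ F v y)
    (hcont : ∀ u : ℕ → M → EReal, (∀ k, Measurable (u k)) →
      (∀ x : M, Monotone fun k => u k x) →
      ∀ y, Tendsto (fun k => F (u k) y) atTop (nhds (F (fun x => ⨆ k, u k x) y)))
    (hcomp : ∀ f : EReal → EReal, Continuous f → Monotone f →
      ∀ u : M → EReal, Measurable u → F (f ∘ u) = f ∘ F u) :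
    ∃ T : Set M → Set N,
      (∀ A : Set M, MeasurableSet A → MeasurableSet (T A) ∧
        F (A.indicator fun _ => (1 : EReal)) = (T A).indicator fun _ => (1 : EReal)) ∧
      (∀ u : M → EReal, Measurable u → ∀ t : ℝ,
        {y : N | (t : EReal) < F u y} = T {x : M | (t : EReal) < u x}) := by
  have key {u : M → EReal} (hu : Measurable u) (t : ℝ) :=
    indicator_superlevel_of_comp_of_tendsto F hcont hcomp hu t
  refine ⟨fun A => {y | 0 < F (A.indicator fun _ => 1) y}, fun A hA => ?_, fun u hu t => ?_⟩
  · have hχ : Measurable (A.indicator fun _ => (1 : EReal)) := measurable_const.indicator hA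
    refine ⟨measurableSet_lt measurable_const (hFmeas _ hχ), ?_⟩
    have hA' : {x | ((0 : ℝ) : EReal) < A.indicator (fun _ => (1 : EReal)) x} = A := by
      ext x
      by_cases hx : x ∈ A <;> simp [hx]
    have h := key hχ 0
    rwa [hA'] at h
  · ext y
    simp only [key hu t, mem_ofPred_eq]
    by_cases hy : (t : EReal) < F u y <;> simp [hy]
end

section
/- Let M and N be measurable spaces and let ·* be a transformation mapping measurable functions u : M → ℝ̄ to measurable functions u* : N → ℝ̄ that commutes with composition by nondecreasing continuous maps: f ∘ (u*) = (f ∘ u)* for every nondecreasing continuous f : ℝ̄ → ℝ̄. Then for every measurable set A ⊆ M, the function (χ_A)* is the characteristic function of a measurable subset of N, i.e. (χ_A)* takes only the values 0 and 1. -/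
open Set Filter Topology

/-- The clipped doubling map `x ↦ min 1 (max 0 (x + x))` is continuous on `EReal`. -/
theorem continuous_clippedDouble : Continuous fun x : EReal => min 1 (max 0 (x + x)) := by
  have hadd : Continuous fun x : EReal => x + x := by
    refine continuous_iff_continuousAt.2 fun x => ?_
    have h : ContinuousAt (fun p : EReal × EReal => p.1 + p.2) (x, x) := by
      apply EReal.continuousAt_add <;> induction x <;> simp
    exact ContinuousAt.comp (f := fun x : EReal => (x, x)) h (by fun_prop)
  fun_prop

theorem monotone_clippedDouble : Monotone fun x : EReal => min 1 (max 0 (x + x)) :=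
  fun _ _ h => min_le_min le_rfl (max_le_max le_rfl (add_le_add h h))

/-- The only fixed points of the clipped doubling map are `0` and `1`. -/
theorem eq_zero_or_one_of_clippedDouble_eq {x : EReal} (h : min 1 (max 0 (x + x)) = x) :
    x = 0 ∨ x = 1 := by
  induction x with
  | bot => simp at h
  | top => exact Or.inr (by simpa using h.symm)
  | coe r =>
    have h' : min 1 (max 0 (r + r)) = r := by
      have hcoe : ((min 1 (max 0 (r + r)) : ℝ) : EReal) = r := by
        rw [EReal.coe_strictMono.monotone.map_min, EReal.coe_strictMono.monotone.map_max]
        exact_mod_cast h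
      exact_mod_cast hcoe
    have hr : r = 0 ∨ r = 1 := by grind
    exact_mod_cast hr

/-- A transformation of measurable functions that commutes with composition
with continuous nondecreasing maps sends characteristic functions of measurable sets to
characteristic functions of measurable sets. -/
theorem statement6 {M N : Type*} [MeasurableSpace M] [MeasurableSpace N]
    (F : (M → EReal) → N → EReal)
    (hFmeas : ∀ u : M → EReal, Measurable u → Measurable (F u))
    (hcomp : ∀ f : EReal → EReal, Continuous f → Monotone f →
      ∀ u : M → EReal, Measurable u → F (f ∘ u) = f ∘ F u) :
    ∀ A : Set M, MeasurableSet A → ∃ S : Set N, MeasurableSet S ∧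
      F (A.indicator fun _ => (1 : EReal)) = S.indicator fun _ => (1 : EReal) := by
  intro A hA
  set u : M → EReal := A.indicator fun _ => (1 : EReal) with hu
  have hum : Measurable u := measurable_const.indicator hA
  have hfix : (fun x : EReal => min 1 (max 0 (x + x))) ∘ u = u := by
    funext x
    have h1 : (1 : EReal) ≤ 1 + 1 := by exact_mod_cast (by norm_num : (1 : ℝ) ≤ 1 + 1)
    by_cases hx : x ∈ A <;> simp [hu, hx, h1]
  have hF := hcomp _ continuous_clippedDouble monotone_clippedDouble u hum
  rw [hfix] at hF
  refine ⟨F u ⁻¹' {1}, hFmeas u hum (measurableSet_singleton 1), funext fun y => ?_⟩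
  rcases eq_zero_or_one_of_clippedDouble_eq (congrFun hF y).symm with h | h <;>
    simp [Set.indicator, h]
end

section
/- (Sufficient condition for the Pólya–Szegő inequality, Euclidean version.) Let ·* be a transformation of Borel subsets of ℝ^n inducing a transformation of functions acting on level sets. Let φ, ψ : ℝ^n × ℝ^n → [0, +∞] be Borel measurable with φ(x, 0) = 0 and ψ(y, 0) = 0 for all x, y. Assume ψ is locally coercive and that for every y ∈ ℝ^n the map ξ ↦ ψ(y, ξ) is convex and lower semicontinuous. Suppose that for every pair of Borel sets A ⊆ B ⊆ ℝ^n and every λ > 0, capa_{ψ,λ}(A*, B*) ≤ capa_{φ,λ}(A, B). If u ∈ W^{1,1}_loc(ℝ^n) is Borel measurable, u* ∈ L¹_loc(ℝ^n), and ∫_{ℝ^n} φ(x, du(x)) dx < ∞, then u* ∈ W^{1,1}_loc(ℝ^n) and ∫_{ℝ^n} ψ(y, du*(y)) dy ≤ ∫_{ℝ^n} φ(x, du(x)) dx. -/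
open MeasureTheory Set Filter Topology ENNReal

noncomputable section

abbrev En (n : ℕ) := EuclideanSpace ℝ (Fin n)

/-- `Du` is the weak gradient of `u` on `ℝⁿ`. -/
def HasWeakGradient {n : ℕ} (u : En n → ℝ) (Du : En n → En n) : Prop :=
  LocallyIntegrable u volume ∧ LocallyIntegrable Du volume ∧
    ∀ φ : En n → ℝ, ContDiff ℝ (⊤ : ℕ∞) φ → HasCompactSupport φ → ∀ i : Fin n,
      ∫ x, u x * fderiv ℝ φ x (EuclideanSpace.single i 1) = - ∫ x, Du x i * φ x

/-- The capacity `capa_{Φ,λ}(A,B)` associated to the integrand `Φ` and the level `λ`. -/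
def capaGen {n : ℕ} (Φ : En n → En n → ℝ≥0∞) (lam : ℝ) (A B : Set (En n)) : ℝ≥0∞ :=
  ⨅ (u : En n → ℝ) (Du : En n → En n) (_ : HasWeakGradient u Du)
    (_ : ∀ x ∈ A, u x = lam) (_ : ∀ x ∉ B, u x = 0), ∫⁻ x, Φ x (Du x)

/-- `Ψ` is locally coercive: `ψ(x,ξ)/‖ξ‖` tends to `∞` uniformly for `x` in a compact set. -/
def LocallyCoercive {n : ℕ} (Ψ : En n → En n → ℝ≥0∞) : Prop :=
  ∀ K : Set (En n), IsCompact K → ∀ C : ℝ, ∃ r : ℝ, ∀ x ∈ K, ∀ ξ : En n,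
    r ≤ ‖ξ‖ → ENNReal.ofReal (C * ‖ξ‖) ≤ Ψ x ξ

/-- A transformation of Borel sets of `ℝⁿ` inducing a transformation of Borel functions acting
on level sets. -/
structure SetRearrangement (n : ℕ) where
  setMap : Set (En n) → Set (En n)
  fnMap : (En n → EReal) → En n → EReal
  measurableSet_setMap : ∀ A : Set (En n), MeasurableSet A → MeasurableSet (setMap A)
  setMap_empty : setMap ∅ = ∅
  setMap_univ : setMap univ = univ
  measurable_fnMap : ∀ u : En n → EReal, Measurable u → Measurable (fnMap u)
  levelSet_fnMap : ∀ u : En n → EReal, Measurable u → ∀ t : ℝ,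
    {y | (t : EReal) < fnMap u y} = setMap {x | (t : EReal) < u x}

open scoped Convolution in
/-- Mollification of a real function by a normed bump function. -/
def mollify {n : ℕ} (ρ : ContDiffBump (0 : En n)) (g : En n → ℝ) : En n → ℝ :=
  ρ.normed volume ⋆[ContinuousLinearMap.lsmul ℝ ℝ, volume] g

/-- A sequence of bump functions with supports shrinking to the origin. -/
def stdBump (n : ℕ) (k : ℕ) : ContDiffBump (0 : En n) where
  rIn := 1 / (2 * (k + 1))
  rOut := 1 / (k + 1)
  rIn_pos := by positivity
  rIn_lt_rOut := by
    apply one_div_lt_one_div_of_lt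
    · positivity
    · linarith [show (0 : ℝ) ≤ k by positivity]

lemma mollify_apply {n : ℕ} (ρ : ContDiffBump (0 : En n)) (g : En n → ℝ) (x : En n) :
    mollify ρ g x = ∫ t, ρ.normed volume (x - t) * g t := by
  simp [mollify, convolution_lsmul_swap]

lemma integrable_mollify_integrand {n : ℕ} (ρ : ContDiffBump (0 : En n)) {g : En n → ℝ}
    (hg : LocallyIntegrable g) (x : En n) :
    Integrable (fun t => ρ.normed volume (x - t) * g t) := by
  have := (ρ.hasCompactSupport_normed (μ := volume)).convolutionExists_left (μ := volume)
    (ContinuousLinearMap.lsmul ℝ ℝ) ρ.continuous_normed hg x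
  simpa using this.integrable_swap

lemma contDiff_mollify {n : ℕ} (ρ : ContDiffBump (0 : En n)) {g : En n → ℝ}
    (hg : LocallyIntegrable g) : ContDiff ℝ 1 (mollify ρ g) :=
  (ρ.hasCompactSupport_normed (μ := volume)).contDiff_convolution_left (n := 1) _
    (ρ.contDiff_normed (μ := volume)) hg

lemma tendsto_stdBump_rOut (n : ℕ) : Tendsto (fun k => (stdBump n k).rOut) atTop (𝓝 0) :=
  tendsto_one_div_add_atTop_nhds_zero_nat

lemma ae_tendsto_mollify {n : ℕ} {g : En n → ℝ} (hg : LocallyIntegrable g) :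
    ∀ᵐ x, Tendsto (fun k => mollify (stdBump n k) g x) atTop (𝓝 (g x)) := by
  refine ContDiffBump.ae_convolution_tendsto_right_of_locallyIntegrable (K := 2)
    (tendsto_stdBump_rOut n) (Eventually.of_forall fun k => ?_) hg
  have : (0 : ℝ) < k + 1 := by positivity
  simp only [stdBump]
  apply le_of_eq
  field_simp

lemma tendsto_integral_abs_mollify_sub_of_nonneg {n : ℕ} {g : En n → ℝ} (hg : Integrable g)
    (h0 : ∀ x, 0 ≤ g x) :
    Tendsto (fun k => ∫ x, |mollify (stdBump n k) g x - g x|) atTop (𝓝 0) := by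
  have hint : ∀ k, Integrable (mollify (stdBump n k) g) := fun k =>
    (stdBump n k).integrable_normed.integrable_convolution _ hg
  have hnn : ∀ k x, 0 ≤ mollify (stdBump n k) g x := fun k x => by
    rw [mollify_apply]
    exact integral_nonneg fun t => mul_nonneg ((stdBump n k).nonneg_normed _) (h0 t)
  have heq : ∀ k, ∫ x, mollify (stdBump n k) g x = ∫ x, g x := fun k => by
    unfold mollify
    rw [integral_convolution _ (stdBump n k).integrable_normed hg]
    simp [ContDiffBump.integral_normed]
  have hkey : ∀ k, ∫ x, |mollify (stdBump n k) g x - g x|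
      = 2 * ∫ x, max (g x - mollify (stdBump n k) g x) 0 := fun k => by
    have h1 : ∀ x, |mollify (stdBump n k) g x - g x|
        = 2 * max (g x - mollify (stdBump n k) g x) 0 + (mollify (stdBump n k) g x - g x) := by
      intro x
      rcases le_total (g x) (mollify (stdBump n k) g x) with h | h
      · rw [abs_of_nonneg (by linarith), max_eq_right (by linarith)]; ring
      · rw [abs_of_nonpos (by linarith), max_eq_left (by linarith)]; ring
    simp_rw [h1]
    have hp : Integrable (fun x => 2 * max (g x - mollify (stdBump n k) g x) 0) :=
      ((hg.sub (hint k)).pos_part).const_mul 2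
    have hs : Integrable (fun x => mollify (stdBump n k) g x - g x) := (hint k).sub hg
    rw [integral_add hp hs, integral_sub (hint k) hg, heq, integral_const_mul]
    simp
  simp_rw [hkey]
  have : Tendsto (fun k => ∫ x, max (g x - mollify (stdBump n k) g x) 0) atTop
      (𝓝 (∫ _ : En n, (0 : ℝ))) := by
    refine tendsto_integral_of_dominated_convergence g
      (fun k => ((hg.sub (hint k)).pos_part).aestronglyMeasurable) hg (fun k => ?_) ?_
    · refine Eventually.of_forall fun x => ?_
      rw [Real.norm_of_nonneg (le_max_right _ _)]
      exact max_le (by linarith [hnn k x]) (h0 x)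
    · filter_upwards [ae_tendsto_mollify hg.locallyIntegrable] with x hx
      have := (tendsto_const_nhds (x := g x)).sub hx
      simpa using this.max (tendsto_const_nhds (x := (0 : ℝ)))
  simpa using this.const_mul 2

lemma mollify_sub {n : ℕ} (ρ : ContDiffBump (0 : En n)) {f g : En n → ℝ}
    (hf : LocallyIntegrable f) (hg : LocallyIntegrable g) (x : En n) :
    mollify ρ (fun y => f y - g y) x = mollify ρ f x - mollify ρ g x := by
  simp only [mollify_apply, mul_sub]
  exact integral_sub (integrable_mollify_integrand ρ hf x) (integrable_mollify_integrand ρ hg x)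

lemma tendsto_integral_abs_mollify_sub {n : ℕ} {g : En n → ℝ} (hg : Integrable g) :
    Tendsto (fun k => ∫ x, |mollify (stdBump n k) g x - g x|) atTop (𝓝 0) := by
  have hp : Integrable (fun x => max (g x) 0) := hg.pos_part
  have hn : Integrable (fun x => max (-g x) 0) := hg.neg_part
  have hint : ∀ {f : En n → ℝ} (_ : Integrable f) k,
      Integrable (fun x => |mollify (stdBump n k) f x - f x|) := fun hf k =>
    (((stdBump n k).integrable_normed.integrable_convolution _ hf).sub hf).abs
  have hsum := (tendsto_integral_abs_mollify_sub_of_nonneg hp fun x => le_max_right _ _).add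
    (tendsto_integral_abs_mollify_sub_of_nonneg hn fun x => le_max_right _ _)
  rw [add_zero] at hsum
  refine squeeze_zero (fun k => integral_nonneg fun x => abs_nonneg _) (fun k => ?_) hsum
  rw [← integral_add (hint hp k) (hint hn k)]
  refine integral_mono (hint hg k) ((hint hp k).add (hint hn k)) fun x => ?_
  have hgx : ∀ y, g y = max (g y) 0 - max (-g y) 0 := fun y => by
    rcases le_total 0 (g y) with h | h
    · simp [h]
    · simp [h]
  have : mollify (stdBump n k) g x = mollify (stdBump n k) (fun y => max (g y) 0) x
      - mollify (stdBump n k) (fun y => max (-g y) 0) x := by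
    rw [← mollify_sub _ hp.locallyIntegrable hn.locallyIntegrable]
    congr 1
    exact funext hgx
  change |_| ≤ |_| + |_|
  refine le_trans (le_of_eq ?_) (abs_sub _ _)
  congr 1
  linarith [hgx x]

lemma tendsto_setIntegral_abs_mollify_sub {n : ℕ} {g : En n → ℝ} (hg : LocallyIntegrable g)
    {K : Set (En n)} (hK : IsCompact K) :
    Tendsto (fun k => ∫ x in K, |mollify (stdBump n k) g x - g x|) atTop (𝓝 0) := by
  have hK' : IsCompact (Metric.cthickening 1 K) := hK.cthickening
  have hmeas : MeasurableSet (Metric.cthickening 1 K) := hK'.measurableSet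
  have hG : Integrable ((Metric.cthickening 1 K).indicator g) :=
    (integrable_indicator_iff hmeas).2 (hg.integrableOn_isCompact hK')
  have hint : ∀ k, Integrable (fun x => |mollify (stdBump n k)
      ((Metric.cthickening 1 K).indicator g) x - (Metric.cthickening 1 K).indicator g x|) := fun k =>
    (((stdBump n k).integrable_normed.integrable_convolution _ hG).sub hG).abs
  refine squeeze_zero (fun k => integral_nonneg fun x => abs_nonneg _) (fun k => ?_)
    (tendsto_integral_abs_mollify_sub hG)
  refine le_trans (le_of_eq ?_) (setIntegral_le_integral (s := K) (hint k)
    (Eventually.of_forall fun x => abs_nonneg _))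
  refine setIntegral_congr_fun hK.measurableSet fun x hx => ?_
  have h1 : (Metric.cthickening 1 K).indicator g x = g x :=
    indicator_of_mem (Metric.self_subset_cthickening K hx) g
  have h2 : mollify (stdBump n k) ((Metric.cthickening 1 K).indicator g) x
      = mollify (stdBump n k) g x := by
    simp only [mollify_apply]
    refine integral_congr_ae (Eventually.of_forall fun t => ?_)
    by_cases ht : t ∈ Metric.cthickening 1 K
    · simp [ht]
    · have : (stdBump n k).normed volume (x - t) = 0 := by
        rw [← Function.notMem_support, ContDiffBump.support_normed_eq]
        intro hmem
        apply ht
        refine Metric.mem_cthickening_of_dist_le t x 1 K hx ?_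
        rw [Metric.mem_ball, dist_zero_right, ← dist_eq_norm, dist_comm] at hmem
        refine hmem.le.trans ?_
        simp only [stdBump]
        rw [div_le_one (by positivity)]
        linarith [show (0 : ℝ) ≤ k by positivity]
      simp [this]
  simp only [h1, h2]

lemma fderiv_mollify {n : ℕ} (ρ : ContDiffBump (0 : En n)) {u : En n → ℝ} {Du : En n → En n}
    (h : HasWeakGradient u Du) (x : En n) (i : Fin n) :
    fderiv ℝ (mollify ρ u) x (EuclideanSpace.single i 1) = mollify ρ (fun y => Du y i) x := by
  have hd := ρ.hasCompactSupport_normed.hasFDerivAt_convolution_left (μ := volume)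
    (ContinuousLinearMap.lsmul ℝ ℝ) (ρ.contDiff_normed (n := 1) (μ := volume)) h.1 x
  have hexi := (ρ.hasCompactSupport_normed.fderiv ℝ).convolutionExists_left (μ := volume)
    ((ContinuousLinearMap.lsmul ℝ ℝ).precompL (En n))
    ((ρ.contDiff_normed (n := 1) (μ := volume)).continuous_fderiv one_ne_zero) h.1 x
  change HasFDerivAt (mollify ρ u) _ x at hd
  rw [hd.fderiv, convolution_eq_swap,
    ContinuousLinearMap.integral_apply (by simpa using hexi.integrable_swap), mollify_apply]
  have hsm : ContDiff ℝ (⊤ : ℕ∞) (fun t => ρ.normed volume (x - t)) :=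
    (ρ.contDiff_normed (μ := volume)).comp (contDiff_const.sub contDiff_id)
  have hcs : HasCompactSupport (fun t => ρ.normed volume (x - t)) :=
    ρ.hasCompactSupport_normed.comp_homeomorph (Homeomorph.subLeft x)
  have hweak := h.2.2 _ hsm hcs i
  have hder : ∀ t, fderiv ℝ (fun t => ρ.normed volume (x - t)) t (EuclideanSpace.single i 1)
      = - fderiv ℝ (ρ.normed volume) (x - t) (EuclideanSpace.single i 1) := fun t => by
    have h1 : HasFDerivAt (fun t : En n => x - t) (-ContinuousLinearMap.id ℝ (En n)) t := by
      simpa using (hasFDerivAt_id t).const_sub x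
    have h2 := ((ρ.contDiff_normed (n := 1) (μ := volume)).differentiable one_ne_zero
      (x - t)).hasFDerivAt.comp t h1
    rw [show (fun t => ρ.normed volume (x - t)) = ρ.normed volume ∘ (fun t => x - t) from rfl,
      h2.fderiv]
    simp
  simp only [hder, mul_neg, integral_neg, neg_inj] at hweak
  simpa [mul_comm, ContinuousLinearMap.precompL_apply] using hweak

lemma tendsto_integral_mul_of_tendsto_setIntegral {n : ℕ} {f : ℕ → En n → ℝ} {g η : En n → ℝ}
    (hf : ∀ k, LocallyIntegrable (f k)) (hg : LocallyIntegrable g)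
    (hη : Continuous η) (hηc : HasCompactSupport η)
    (h : Tendsto (fun k => ∫ x in tsupport η, |f k x - g x|) atTop (𝓝 0)) :
    Tendsto (fun k => ∫ x, f k x * η x) atTop (𝓝 (∫ x, g x * η x)) := by
  obtain ⟨M, hM⟩ := hηc.exists_bound_of_continuous hη
  have hint : ∀ {q : En n → ℝ}, LocallyIntegrable q → Integrable (fun x => q x * η x) := fun hq => by
    simpa [mul_comm] using hq.integrable_smul_left_of_hasCompactSupport hη hηc
  rw [tendsto_iff_norm_sub_tendsto_zero]
  refine squeeze_zero (fun _ => norm_nonneg _) (fun k => ?_) (by simpa using h.const_mul M)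
  rw [← integral_sub (hint (hf k)) (hint hg),
    ← setIntegral_eq_integral_of_forall_compl_eq_zero (s := tsupport η) (fun x hx => by
      simp [image_eq_zero_of_notMem_tsupport hx]), ← integral_const_mul]
  have hi : IntegrableOn (fun x => |f k x - g x|) (tsupport η) :=
    (((hf k).sub hg).integrableOn_isCompact hηc).abs
  refine norm_integral_le_of_norm_le (hi.const_mul M) (Eventually.of_forall fun x => ?_)
  rw [← sub_mul, norm_mul, mul_comm, Real.norm_eq_abs (f k x - g x)]
  exact mul_le_mul_of_nonneg_right (hM x) (abs_nonneg _)

lemma locallyIntegrable_coord {n : ℕ} {D : En n → En n} (h : LocallyIntegrable D) (i : Fin n) :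
    LocallyIntegrable (fun x => D x i) :=
  h.mono ((EuclideanSpace.proj (𝕜 := ℝ) i).continuous.comp_aestronglyMeasurable
    h.aestronglyMeasurable) (Eventually.of_forall fun x => PiLp.norm_apply_le (D x) i)

lemma lipschitz_of_abs_deriv_le_one {F h : ℝ → ℝ} (hF : ∀ t, HasDerivAt F (h t) t)
    (hb : ∀ t, |h t| ≤ 1) (s t : ℝ) : |F s - F t| ≤ |s - t| := by
  simpa using Convex.norm_image_sub_le_of_norm_hasDerivWithin_le (s := univ) (x := t) (y := s)
    (fun x _ => (hF x).hasDerivWithinAt) (fun x _ => hb x) convex_univ (mem_univ _) (mem_univ _)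

lemma locallyIntegrable_comp_lipschitz {n : ℕ} {u : En n → ℝ} (hu : LocallyIntegrable u)
    {F : ℝ → ℝ} (hF : Continuous F) (hl : ∀ s t, |F s - F t| ≤ |s - t|) :
    LocallyIntegrable (fun x => F (u x)) := by
  have h1 : LocallyIntegrable (fun x => |F 0| + |u x|) :=
    (locallyIntegrable_const |F 0|).add
    (hu.mono hu.aestronglyMeasurable.norm (Eventually.of_forall fun x => by simp))
  refine h1.mono (hF.comp_aestronglyMeasurable hu.aestronglyMeasurable)
    (Eventually.of_forall fun x => ?_)
  rw [Real.norm_eq_abs, Real.norm_of_nonneg (by positivity)]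
  have h2 := hl (u x) 0
  rw [sub_zero] at h2
  have h3 := abs_add_le (F (u x) - F 0) (F 0)
  rw [sub_add_cancel] at h3
  linarith

lemma chain_rule_of_continuous {n : ℕ} {u : En n → ℝ} {Du : En n → En n}
    (hw : HasWeakGradient u Du) {F h : ℝ → ℝ} (hF : ∀ t, HasDerivAt F (h t) t)
    (hh : Continuous h) (hb : ∀ t, |h t| ≤ 1) {η : En n → ℝ} (hη : ContDiff ℝ (⊤ : ℕ∞) η)
    (hηc : HasCompactSupport η) (i : Fin n) :
    ∫ x, F (u x) * fderiv ℝ η x (EuclideanSpace.single i 1)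
      = - ∫ x, h (u x) * Du x i * η x := by
  have hFc : Continuous F := continuous_iff_continuousAt.2 fun t => (hF t).continuousAt
  have hl := lipschitz_of_abs_deriv_le_one hF hb
  have hDi := locallyIntegrable_coord hw.2.1 i
  have hηd : Continuous (fun x => fderiv ℝ η x (EuclideanSpace.single i 1)) :=
    (hη.continuous_fderiv (by simp)).clm_apply continuous_const
  have hηdc : HasCompactSupport (fun x => fderiv ℝ η x (EuclideanSpace.single i 1)) :=
    hηc.fderiv_apply ℝ _
  set U : ℕ → En n → ℝ := fun k => mollify (stdBump n k) u with hU
  have hUc : ∀ k, ContDiff ℝ 1 (U k) := fun k => contDiff_mollify _ hw.1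
  set D : ℕ → En n → ℝ := fun k => mollify (stdBump n k) (fun y => Du y i) with hD
  have hDc : ∀ k, Continuous (D k) := fun k => (contDiff_mollify _ hDi).continuous
  have hUd : ∀ k x, fderiv ℝ (U k) x (EuclideanSpace.single i 1) = D k x :=
    fun k x => fderiv_mollify _ hw x i
  have hIBP : ∀ k, ∫ x, F (U k x) * fderiv ℝ η x (EuclideanSpace.single i 1)
      = - ∫ x, h (U k x) * D k x * η x := fun k => by
    have hder : ∀ x, fderiv ℝ (fun x => F (U k x)) x (EuclideanSpace.single i 1)
        = h (U k x) * D k x := fun x => by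
      have := (hF (U k x)).comp_hasFDerivAt x
        ((hUc k).differentiable one_ne_zero x).hasFDerivAt
      rw [show (fun x => F (U k x)) = F ∘ U k from rfl, this.fderiv, ← hUd]
      simp
    have hcs : Continuous fun x => F (U k x) := hFc.comp (hUc k).continuous
    rw [integral_mul_fderiv_eq_neg_fderiv_mul_of_integrable]
    · simp_rw [hder]
    · simp_rw [hder]
      exact (((hh.comp (hUc k).continuous).mul (hDc k)).mul hη.continuous).integrable_of_hasCompactSupport
        hηc.mul_left
    · exact (hcs.mul hηd).integrable_of_hasCompactSupport hηdc.mul_left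
    · exact (hcs.mul hη.continuous).integrable_of_hasCompactSupport hηc.mul_left
    · exact fun x _ => (hF (U k x)).differentiableAt.comp x
        ((hUc k).differentiable one_ne_zero x)
    · exact fun x _ => hη.differentiable (by simp) x
  have hL : Tendsto (fun k => ∫ x, F (U k x) * fderiv ℝ η x (EuclideanSpace.single i 1)) atTop
      (𝓝 (∫ x, F (u x) * fderiv ℝ η x (EuclideanSpace.single i 1))) := by
    have hlu := fun k => (hUc k).continuous.locallyIntegrable (μ := volume)
    have hFk := fun k => locallyIntegrable_comp_lipschitz (hlu k) hFc hl
    have hFu := locallyIntegrable_comp_lipschitz hw.1 hFc hl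
    refine tendsto_integral_mul_of_tendsto_setIntegral hFk hFu hηd hηdc ?_
    refine squeeze_zero (fun k => integral_nonneg fun x => abs_nonneg _) (fun k => ?_)
      (tendsto_setIntegral_abs_mollify_sub hw.1 hηdc)
    exact integral_mono (((hFk k).sub hFu).integrableOn_isCompact hηdc).abs
      (((hlu k).sub hw.1).integrableOn_isCompact hηdc).abs fun x => hl _ _
  have hhm : AEStronglyMeasurable (fun x => h (u x)) :=
    hh.comp_aestronglyMeasurable hw.1.aestronglyMeasurable
  have hhD : LocallyIntegrable (fun x => h (u x) * Du x i) := by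
    refine hDi.mono (hhm.mul hDi.aestronglyMeasurable) (Eventually.of_forall fun x => ?_)
    rw [norm_mul]
    exact mul_le_of_le_one_left (norm_nonneg _) (hb _)
  have hR : Tendsto (fun k => ∫ x, h (U k x) * D k x * η x) atTop
      (𝓝 (∫ x, h (u x) * Du x i * η x)) := by
    have hk := fun k => ((hh.comp (hUc k).continuous).mul (hDc k)).locallyIntegrable (μ := volume)
    refine tendsto_integral_mul_of_tendsto_setIntegral hk hhD hη.continuous hηc ?_
    have hDiK := hDi.integrableOn_isCompact hηc
    have h2 : Tendsto (fun k => ∫ x in tsupport η, |h (U k x) - h (u x)| * |Du x i|) atTop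
        (𝓝 (∫ x in tsupport η, (0 : ℝ))) := by
      refine tendsto_integral_of_dominated_convergence (fun x => 2 * |Du x i|) (fun k => ?_)
        (hDiK.abs.const_mul 2) (fun k => Eventually.of_forall fun x => ?_) ?_
      · exact (((hh.comp (hUc k).continuous).aestronglyMeasurable.sub hhm).norm.mul
          hDi.aestronglyMeasurable.norm).restrict
      · rw [Real.norm_of_nonneg (by positivity)]
        refine mul_le_mul_of_nonneg_right ?_ (abs_nonneg _)
        have := abs_sub (h (U k x)) (h (u x))
        linarith [hb (U k x), hb (u x)]
      · filter_upwards [ae_restrict_of_ae (ae_tendsto_mollify hw.1)] with x hx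
        have h3 : Tendsto (fun k => h (U k x)) atTop (𝓝 (h (u x))) := (hh.tendsto _).comp hx
        have := ((h3.sub_const (h (u x))).abs).mul_const |Du x i|
        simpa using this
    have hsum := (tendsto_setIntegral_abs_mollify_sub hDi hηc).add h2
    rw [integral_zero, add_zero] at hsum
    refine squeeze_zero (fun k => integral_nonneg fun x => abs_nonneg _) (fun k => ?_) hsum
    have i1 : IntegrableOn (fun x => |D k x - Du x i|) (tsupport η) :=
      ((((hDc k).locallyIntegrable (μ := volume)).sub hDi).integrableOn_isCompact hηc).abs
    have i2 : IntegrableOn (fun x => |h (U k x) - h (u x)| * |Du x i|) (tsupport η) := by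
      refine Integrable.mono (hDiK.const_mul 2) ?_ (Eventually.of_forall fun x => ?_)
      · exact (((hh.comp (hUc k).continuous).aestronglyMeasurable.sub hhm).norm.mul
          hDi.aestronglyMeasurable.norm).restrict
      · rw [norm_mul, norm_mul, Real.norm_eq_abs, Real.norm_eq_abs, abs_abs, abs_abs,
          Real.norm_eq_abs]
        refine mul_le_mul_of_nonneg_right ?_ (abs_nonneg _)
        have := abs_sub (h (U k x)) (h (u x))
        norm_num
        linarith [hb (U k x), hb (u x)]
    rw [← integral_add i1 i2]
    refine integral_mono (((hk k).sub hhD).integrableOn_isCompact hηc).abs (i1.add i2) fun x => ?_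
    change |h (U k x) * D k x - h (u x) * Du x i| ≤
      |D k x - Du x i| + |h (U k x) - h (u x)| * |Du x i|
    have e : h (U k x) * D k x - h (u x) * Du x i
        = h (U k x) * (D k x - Du x i) + (h (U k x) - h (u x)) * Du x i := by ring
    rw [e]
    refine (abs_add_le _ _).trans ?_
    rw [abs_mul, abs_mul]
    gcongr
    exact mul_le_of_le_one_left (abs_nonneg _) (hb _)
  refine tendsto_nhds_unique hL ?_
  simp_rw [hIBP]
  exact hR.neg

/-- Continuous approximations of the indicator function of `(a, b)`. -/
def rampApprox (a b : ℝ) (k : ℕ) (t : ℝ) : ℝ := max 0 (min 1 (k * min (t - a) (b - t)))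

lemma continuous_rampApprox (a b : ℝ) (k : ℕ) : Continuous (rampApprox a b k) := by
  unfold rampApprox; fun_prop

lemma abs_rampApprox_le (a b : ℝ) (k : ℕ) (t : ℝ) : |rampApprox a b k t| ≤ 1 := by
  unfold rampApprox
  rw [abs_of_nonneg (le_max_left _ _)]
  exact max_le zero_le_one (min_le_left _ _)

lemma tendsto_rampApprox (a b t : ℝ) :
    Tendsto (fun k => rampApprox a b k t) atTop (𝓝 ((Ioo a b).indicator 1 t)) := by
  by_cases h : t ∈ Ioo a b
  · rw [indicator_of_mem h]
    have hm : 0 < min (t - a) (b - t) := lt_min (by linarith [h.1]) (by linarith [h.2])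
    refine tendsto_const_nhds.congr' ?_
    filter_upwards [(tendsto_natCast_atTop_atTop.atTop_mul_const hm).eventually_ge_atTop 1]
      with k hk
    simp [rampApprox, min_eq_left hk]
  · rw [indicator_of_notMem h]
    have hm : min (t - a) (b - t) ≤ 0 := by
      by_contra! hc
      exact h ⟨by linarith [lt_min_iff.1 hc], by linarith [lt_min_iff.1 hc]⟩
    refine tendsto_const_nhds.congr fun k => ?_
    have := mul_nonpos_of_nonneg_of_nonpos (Nat.cast_nonneg (α := ℝ) k) hm
    rw [rampApprox, max_eq_left ((min_le_right _ _).trans this)]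

lemma integral_indicator_Ioo (a b t : ℝ) (hab : a ≤ b) :
    ∫ s in a..t, (Ioo a b).indicator (1 : ℝ → ℝ) s = max 0 (min (t - a) (b - a)) := by
  rcases le_total a t with h | h
  · rw [intervalIntegral.integral_of_le h, setIntegral_indicator measurableSet_Ioo]
    rcases lt_or_ge t b with h' | h'
    · rw [show Ioc a t ∩ Ioo a b = Ioc a t by ext; grind]
      simp [h, h'.le]
    · rw [show Ioc a t ∩ Ioo a b = Ioo a b by ext; grind]
      simp [h', hab]
  · rw [intervalIntegral.integral_of_ge h, setIntegral_indicator measurableSet_Ioo,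
      show Ioc t a ∩ Ioo a b = ∅ by ext; simp; intros; linarith]
    rw [max_eq_left ((min_le_left _ _).trans (by linarith))]
    simp

/-- Truncations of a weakly differentiable function are weakly differentiable. -/
lemma HasWeakGradient.truncate {n : ℕ} {u : En n → ℝ} {Du : En n → En n}
    (hw : HasWeakGradient u Du) {a b : ℝ} (hab : a ≤ b) :
    HasWeakGradient (fun x => max 0 (min (u x - a) (b - a))) ((u ⁻¹' Ioo a b).indicator Du) := by
  have hcont : Continuous fun t : ℝ => max 0 (min (t - a) (b - a)) := by fun_prop
  have hnull : NullMeasurableSet (u ⁻¹' Ioo a b) :=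
    hw.1.aestronglyMeasurable.aemeasurable.nullMeasurable measurableSet_Ioo
  refine ⟨locallyIntegrable_comp_lipschitz hw.1 hcont fun s t => ?_, hw.2.1.mono
    (hw.2.1.aestronglyMeasurable.indicator₀ hnull) (Eventually.of_forall fun x =>
      norm_indicator_le_norm_self _ _), fun η hη hηc i => ?_⟩
  · refine (abs_max_sub_max_le_max _ _ _ _).trans (max_le (by simp) ?_)
    refine (abs_min_sub_min_le_max _ _ _ _).trans (max_le (by simp) (by simp))
  have hDi := locallyIntegrable_coord hw.2.1 i
  have hηd : Continuous (fun x => fderiv ℝ η x (EuclideanSpace.single i 1)) :=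
    (hη.continuous_fderiv (by simp)).clm_apply continuous_const
  have hηdc : HasCompactSupport (fun x => fderiv ℝ η x (EuclideanSpace.single i 1)) :=
    hηc.fderiv_apply ℝ _
  set F : ℕ → ℝ → ℝ := fun k t => ∫ s in a..t, rampApprox a b k s with hFdef
  have hF : ∀ k t, HasDerivAt (F k) (rampApprox a b k t) t := fun k t =>
    (continuous_rampApprox a b k).integral_hasStrictDerivAt a t |>.hasDerivAt
  have hchain := fun k => chain_rule_of_continuous hw (hF k) (continuous_rampApprox a b k)
    (abs_rampApprox_le a b k) hη hηc i
  have hFlim : ∀ t, Tendsto (fun k => F k t) atTop (𝓝 (max 0 (min (t - a) (b - a)))) := fun t => by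
    rw [← integral_indicator_Ioo a b t hab]
    refine intervalIntegral.tendsto_integral_filter_of_dominated_convergence (fun _ => 1)
      (Eventually.of_forall fun k => (continuous_rampApprox a b k).aestronglyMeasurable)
      (Eventually.of_forall fun k => Eventually.of_forall fun s _ => abs_rampApprox_le a b k s)
      (by simp) (Eventually.of_forall fun s _ => tendsto_rampApprox a b s)
  have hL : Tendsto (fun k => ∫ x, F k (u x) * fderiv ℝ η x (EuclideanSpace.single i 1)) atTop
      (𝓝 (∫ x, max 0 (min (u x - a) (b - a)) * fderiv ℝ η x (EuclideanSpace.single i 1))) := by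
    have hFc : ∀ k, Continuous (F k) := fun k =>
      continuous_iff_continuousAt.2 fun t => (hF k t).continuousAt
    have hint : Integrable (fun x => (u x - a) * fderiv ℝ η x (EuclideanSpace.single i 1)) := by
      simpa [mul_comm] using (hw.1.sub (locallyIntegrable_const a)).integrable_smul_left_of_hasCompactSupport
        hηd hηdc
    refine tendsto_integral_of_dominated_convergence _ (fun k =>
      ((hFc k).comp_aestronglyMeasurable hw.1.aestronglyMeasurable).mul
        hηd.aestronglyMeasurable) hint.norm (fun k => Eventually.of_forall fun x => ?_)
      (Eventually.of_forall fun x => (hFlim (u x)).mul_const _)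
    rw [norm_mul, norm_mul]
    refine mul_le_mul_of_nonneg_right ?_ (norm_nonneg _)
    have := lipschitz_of_abs_deriv_le_one (hF k) (abs_rampApprox_le a b k) (u x) a
    simpa [F] using this
  have hR : Tendsto (fun k => ∫ x, rampApprox a b k (u x) * Du x i * η x) atTop
      (𝓝 (∫ x, (u ⁻¹' Ioo a b).indicator Du x i * η x)) := by
    have hint : Integrable (fun x => Du x i * η x) := by
      simpa [mul_comm] using hDi.integrable_smul_left_of_hasCompactSupport hη.continuous hηc
    refine tendsto_integral_of_dominated_convergence _ (fun k =>
      ((((continuous_rampApprox a b k).comp_aestronglyMeasurable hw.1.aestronglyMeasurable).mul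
        hDi.aestronglyMeasurable).mul hη.continuous.aestronglyMeasurable)) hint.norm
        (fun k => Eventually.of_forall fun x => ?_) (Eventually.of_forall fun x => ?_)
    · rw [mul_assoc, norm_mul]
      exact mul_le_of_le_one_left (norm_nonneg _) (abs_rampApprox_le _ _ _ _)
    · have h1 := ((tendsto_rampApprox a b (u x)).mul_const (Du x i)).mul_const (η x)
      convert h1 using 3
      by_cases hx : u x ∈ Ioo a b
      · have hx' : x ∈ u ⁻¹' Ioo a b := hx
        rw [indicator_of_mem hx, indicator_of_mem hx']
        simp
      · have hx' : x ∉ u ⁻¹' Ioo a b := hx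
        rw [indicator_of_notMem hx, indicator_of_notMem hx']
        simp
  refine tendsto_nhds_unique hL ?_
  simp_rw [hchain]
  exact hR.neg

lemma HasWeakGradient.const {n : ℕ} (c : ℝ) :
    HasWeakGradient (fun _ : En n => c) (fun _ => 0) := by
  refine ⟨locallyIntegrable_const c, locallyIntegrable_const 0, fun η hη hηc i => ?_⟩
  have hηd : Continuous (fun x => fderiv ℝ η x (EuclideanSpace.single i 1)) :=
    (hη.continuous_fderiv (by simp)).clm_apply continuous_const
  rw [integral_mul_fderiv_eq_neg_fderiv_mul_of_integrable]
  · simp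
  · simp
  · exact (hηd.integrable_of_hasCompactSupport (hηc.fderiv_apply ℝ _)).const_mul c
  · exact (hη.continuous.integrable_of_hasCompactSupport hηc).const_mul c
  · exact fun x _ => differentiableAt_const c
  · exact fun x _ => hη.differentiable (by simp) x

lemma integrable_mul_test {n : ℕ} {f η : En n → ℝ} (hf : LocallyIntegrable f)
    (hη : Continuous η) (hηc : HasCompactSupport η) : Integrable (fun x => f x * η x) := by
  simpa [mul_comm] using hf.integrable_smul_left_of_hasCompactSupport hη hηc

lemma HasWeakGradient.add {n : ℕ} {u w : En n → ℝ} {Du Dw : En n → En n}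
    (hu : HasWeakGradient u Du) (hw : HasWeakGradient w Dw) :
    HasWeakGradient (u + w) (Du + Dw) := by
  refine ⟨hu.1.add hw.1, hu.2.1.add hw.2.1, fun η hη hηc i => ?_⟩
  have hηd : Continuous (fun x => fderiv ℝ η x (EuclideanSpace.single i 1)) :=
    (hη.continuous_fderiv (by simp)).clm_apply continuous_const
  have hηdc := hηc.fderiv_apply ℝ (EuclideanSpace.single i (1 : ℝ))
  simp only [Pi.add_apply, PiLp.add_apply, add_mul]
  rw [integral_add (integrable_mul_test hu.1 hηd hηdc)
      (integrable_mul_test hw.1 hηd hηdc),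
    integral_add (integrable_mul_test (locallyIntegrable_coord hu.2.1 i)
      hη.continuous hηc) (integrable_mul_test (locallyIntegrable_coord hw.2.1 i)
      hη.continuous hηc), hu.2.2 η hη hηc i, hw.2.2 η hη hηc i]
  ring

lemma HasWeakGradient.smul {n : ℕ} {u : En n → ℝ} {Du : En n → En n}
    (hu : HasWeakGradient u Du) (c : ℝ) : HasWeakGradient (c • u) (c • Du) := by
  refine ⟨hu.1.smul c, hu.2.1.smul c, fun η hη hηc i => ?_⟩
  simp only [Pi.smul_apply, PiLp.smul_apply, smul_eq_mul, mul_assoc]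
  rw [integral_const_mul, integral_const_mul, hu.2.2 η hη hηc i]
  ring

lemma HasWeakGradient.congr_ae {n : ℕ} {u : En n → ℝ} {Du Dw : En n → En n}
    (hu : HasWeakGradient u Du) (h : Du =ᵐ[volume] Dw) : HasWeakGradient u Dw := by
  refine ⟨hu.1, hu.2.1.congr h, fun η hη hηc i => ?_⟩
  rw [hu.2.2 η hη hηc i]
  congr 1
  refine integral_congr_ae ?_
  filter_upwards [h] with x hx
  rw [hx]

lemma HasWeakGradient.const_add_sum {n : ℕ} (c : ℝ) (w : ℕ → En n → ℝ) (Dw : ℕ → En n → En n)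
    (h : ∀ j, HasWeakGradient (w j) (Dw j)) (m : ℕ) :
    HasWeakGradient (fun x => c + ∑ j ∈ Finset.range m, w j x)
      (fun x => ∑ j ∈ Finset.range m, Dw j x) := by
  induction m with
  | zero => simpa using HasWeakGradient.const c
  | succ m ih =>
    convert ih.add (h m) using 1
    · ext x; simp [Finset.sum_range_succ, add_assoc]
    · ext x; simp [Finset.sum_range_succ]

lemma exists_truncated_competitor {n : ℕ} (R : SetRearrangement n) {Φ Ψ : En n → En n → ℝ≥0∞}
    (hΦ0 : ∀ x, Φ x 0 = 0) (hΨ0 : ∀ y, Ψ y 0 = 0)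
    (hcap : ∀ A B : Set (En n), MeasurableSet A → MeasurableSet B → A ⊆ B →
      ∀ lam : ℝ, 0 < lam →
        capaGen Ψ lam (R.setMap A) (R.setMap B) ≤ capaGen Φ lam A B)
    {u : En n → ℝ} {Du : En n → En n} (hum : Measurable u) (hw : HasWeakGradient u Du)
    {v : En n → ℝ} (hvm : Measurable v)
    (hv : ∀ t : ℝ, {y | t < v y} = R.setMap {x | t < u x})
    (hfin : ∫⁻ x, Φ x (Du x) < ⊤) {a b : ℝ} (hab : a < b) {ε : ℝ≥0∞} (hε : ε ≠ 0) :
    ∃ (w : En n → ℝ) (Dw : En n → En n), HasWeakGradient w Dw ∧ Measurable Dw ∧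
      (∀ y, b < v y → w y = b - a) ∧ (∀ y, v y ≤ a → w y = 0) ∧ (∀ y, 0 ≤ w y ∧ w y ≤ b - a) ∧
      (∀ y, v y ∉ Ioc a b → Dw y = 0) ∧
      ∫⁻ y, Ψ y (Dw y) ≤ (∫⁻ x in u ⁻¹' Ioo a b, Φ x (Du x)) + ε := by
  have hfin' : ∫⁻ x in u ⁻¹' Ioo a b, Φ x (Du x) ≠ ⊤ :=
    ((setLIntegral_le_lintegral _ _).trans_lt hfin).ne
  have hle : capaGen Φ (b - a) {x | b < u x} {x | a < u x}
      ≤ ∫⁻ x in u ⁻¹' Ioo a b, Φ x (Du x) := by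
    refine (iInf₂_le _ _).trans ((iInf₂_le (hw.truncate hab.le) fun x hx => ?_).trans
      ((iInf_le _ fun x hx => ?_).trans (le_of_eq ?_)))
    · have hx : b < u x := hx
      rw [min_eq_right (by linarith), max_eq_right (by linarith)]
    · have hx : u x ≤ a := not_lt.1 hx
      exact max_eq_left ((min_le_left _ _).trans (by linarith))
    · rw [← lintegral_indicator (hum measurableSet_Ioo)]
      refine lintegral_congr fun x => ?_
      by_cases hx : x ∈ u ⁻¹' Ioo a b
      · rw [indicator_of_mem hx, indicator_of_mem hx]
      · rw [indicator_of_notMem hx, indicator_of_notMem hx, hΦ0]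
  have hlt : capaGen Ψ (b - a) {y | b < v y} {y | a < v y}
      < (∫⁻ x in u ⁻¹' Ioo a b, Φ x (Du x)) + ε := by
    rw [hv, hv]
    refine ((hcap _ _ (measurableSet_lt measurable_const hum)
      (measurableSet_lt measurable_const hum) (fun x hx => ?_) _ (by linarith)).trans hle).trans_lt
      (ENNReal.lt_add_right hfin' hε)
    exact hab.trans hx
  simp only [capaGen, iInf_lt_iff] at hlt
  obtain ⟨w, Dw, hwD, hwA, hwB, hlt⟩ := hlt
  have hT := hwD.truncate (a := 0) (b := b - a) (by linarith)
  simp only [sub_zero] at hT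
  have hS : MeasurableSet (v ⁻¹' Ioc a b) := hvm measurableSet_Ioc
  obtain ⟨D', hD'm, hD'⟩ : ∃ D' : En n → En n, Measurable D' ∧
      (w ⁻¹' Ioo 0 (b - a)).indicator Dw =ᵐ[volume] D' :=
    ⟨_, hT.2.1.aestronglyMeasurable.stronglyMeasurable_mk.measurable,
      hT.2.1.aestronglyMeasurable.ae_eq_mk⟩
  have hout : ∀ y, v y ∉ Ioc a b → y ∉ w ⁻¹' Ioo 0 (b - a) := fun y hy hwy => by
    rcases le_or_gt (v y) a with h | h
    · have : w y = 0 := hwB y (not_lt.2 h)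
      exact hwy.1.ne' this
    · have : w y = b - a := hwA y (not_le.1 fun h' => hy ⟨h, h'⟩)
      exact hwy.2.ne this
  have hae : (w ⁻¹' Ioo 0 (b - a)).indicator Dw =ᵐ[volume] (v ⁻¹' Ioc a b).indicator D' := by
    filter_upwards [hD'] with y hy
    by_cases h : y ∈ v ⁻¹' Ioc a b
    · rw [indicator_of_mem h, hy]
    · rw [indicator_of_notMem h, indicator_of_notMem (hout y h)]
  refine ⟨_, _, hT.congr_ae hae, hD'm.indicator hS, fun y hy => ?_, fun y hy => ?_, fun y => ?_,
    fun y hy => indicator_of_notMem (s := v ⁻¹' Ioc a b) hy _, ?_⟩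
  · rw [hwA y hy, min_self, max_eq_right (by linarith)]
  · rw [hwB y (not_lt.2 hy), min_eq_left (by linarith), max_self]
  · exact ⟨le_max_left _ _, max_le (by linarith) (min_le_right _ _)⟩
  · refine le_trans (b := ∫⁻ y, Ψ y ((w ⁻¹' Ioo 0 (b - a)).indicator Dw y)) (le_of_eq ?_)
      ((lintegral_mono fun y => ?_).trans hlt.le)
    · refine lintegral_congr_ae ?_
      filter_upwards [hae] with y hy
      rw [hy]
    · by_cases h : y ∈ w ⁻¹' Ioo 0 (b - a)
      · simp [indicator_of_mem h]
      · simp [indicator_of_notMem h, hΨ0]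

/-- Weakly differentiable approximations of `v` with energy at most `I + 1 / (k + 1)`. -/
def approxSet {n : ℕ} (Ψ : En n → En n → ℝ≥0∞) (v : En n → ℝ) (I : ℝ≥0∞) (k : ℕ) :
    Set ((En n → ℝ) × (En n → En n)) :=
  {p | HasWeakGradient p.1 p.2 ∧ Measurable p.2 ∧
    (∀ x, |p.1 x| ≤ |v x| + 1 ∧ (|v x| ≤ k → |p.1 x - v x| ≤ 1 / (k + 1))) ∧
    ∫⁻ y, Ψ y (p.2 y) ≤ I + ((k : ℝ≥0∞) + 1)⁻¹}

lemma approxSet_antitone {n : ℕ} (Ψ : En n → En n → ℝ≥0∞) (v : En n → ℝ) (I : ℝ≥0∞) :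
    Antitone (approxSet Ψ v I) := by
  rintro k l hkl p ⟨h1, h2, h3, h4⟩
  have hc : (k : ℝ) ≤ l := by exact_mod_cast hkl
  refine ⟨h1, h2, fun x => ⟨(h3 x).1, fun hx => ((h3 x).2 (hx.trans hc)).trans ?_⟩, h4.trans ?_⟩
  · gcongr
  · gcongr

lemma midpoint_mem_approxSet {n : ℕ} {Ψ : En n → En n → ℝ≥0∞}
    (hΨmeas : Measurable (Function.uncurry Ψ))
    (hconv : ∀ (y : En n) (ξ η : En n) (a b : ℝ), 0 ≤ a → 0 ≤ b → a + b = 1 →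
      Ψ y (a • ξ + b • η) ≤ ENNReal.ofReal a * Ψ y ξ + ENNReal.ofReal b * Ψ y η)
    {v : En n → ℝ} {I : ℝ≥0∞} {k : ℕ} {p q : (En n → ℝ) × (En n → En n)}
    (hp : p ∈ approxSet Ψ v I k) (hq : q ∈ approxSet Ψ v I k) :
    (2⁻¹ : ℝ) • p + (2⁻¹ : ℝ) • q ∈ approxSet Ψ v I k := by
  obtain ⟨p1, p2, p3, p4⟩ := hp
  obtain ⟨q1, q2, q3, q4⟩ := hq
  refine ⟨(p1.smul _).add (q1.smul _), (p2.const_smul _).add (q2.const_smul _),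
    fun x => ⟨?_, fun hx => ?_⟩, ?_⟩
  · have hp := abs_le.1 (p3 x).1
    have hq := abs_le.1 (q3 x).1
    simp only [Prod.fst_add, Prod.smul_fst, Pi.add_apply, Pi.smul_apply, smul_eq_mul]
    rw [abs_le]
    constructor <;> linarith [hp.1, hp.2, hq.1, hq.2]
  · have hp := abs_le.1 ((p3 x).2 hx)
    have hq := abs_le.1 ((q3 x).2 hx)
    simp only [Prod.fst_add, Prod.smul_fst, Pi.add_apply, Pi.smul_apply, smul_eq_mul]
    rw [abs_le]
    constructor <;> linarith [hp.1, hp.2, hq.1, hq.2]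
  · have hm : ∀ {D : En n → En n}, Measurable D → Measurable fun y => Ψ y (D y) := fun hD =>
      hΨmeas.comp (measurable_id.prodMk hD)
    calc ∫⁻ y, Ψ y ((2⁻¹ : ℝ) • p.2 y + (2⁻¹ : ℝ) • q.2 y)
        ≤ ∫⁻ y, ENNReal.ofReal 2⁻¹ * Ψ y (p.2 y) + ENNReal.ofReal 2⁻¹ * Ψ y (q.2 y) :=
          lintegral_mono fun y => hconv y _ _ _ _ (by norm_num) (by norm_num) (by norm_num)
      _ = ENNReal.ofReal 2⁻¹ * (∫⁻ y, Ψ y (p.2 y)) + ENNReal.ofReal 2⁻¹ * ∫⁻ y, Ψ y (q.2 y) := by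
          rw [lintegral_add_left ((hm p2).const_mul _), lintegral_const_mul _ (hm p2),
            lintegral_const_mul _ (hm q2)]
      _ ≤ ENNReal.ofReal 2⁻¹ * (I + ((k : ℝ≥0∞) + 1)⁻¹)
          + ENNReal.ofReal 2⁻¹ * (I + ((k : ℝ≥0∞) + 1)⁻¹) := by gcongr
      _ = I + ((k : ℝ≥0∞) + 1)⁻¹ := by
          rw [← add_mul, ← ENNReal.ofReal_add (by norm_num) (by norm_num)]
          norm_num

lemma staircase_approx {lam t₀ s : ℝ} (hlam : 0 < lam) {w : ℕ → ℝ}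
    (h1 : ∀ j : ℕ, t₀ + (j + 1) * lam < s → w j = lam) (h0 : ∀ j : ℕ, s ≤ t₀ + j * lam → w j = 0)
    (hb : ∀ j, 0 ≤ w j ∧ w j ≤ lam) (m : ℕ) :
    (s ≤ t₀ → t₀ + ∑ j ∈ Finset.range m, w j = t₀) ∧
    (t₀ < s → s ≤ t₀ + m * lam → |t₀ + ∑ j ∈ Finset.range m, w j - s| ≤ lam) ∧
    (t₀ + m * lam < s → t₀ + ∑ j ∈ Finset.range m, w j = t₀ + m * lam) := by
  induction m with
  | zero =>
    refine ⟨by simp, fun h h' => ?_, by simp⟩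
    simp at h'; linarith
  | succ m ih =>
    obtain ⟨i1, i2, i3⟩ := ih
    have hm : 0 ≤ m * lam := by positivity
    simp only [Finset.sum_range_succ, Nat.cast_add, Nat.cast_one]
    refine ⟨fun h => ?_, fun h h' => ?_, fun h => ?_⟩
    · rw [h0 m (by linarith)]; linarith [i1 h]
    · rcases le_or_gt s (t₀ + m * lam) with hs | hs
      · rw [h0 m hs, add_zero]; exact i2 h hs
      · rw [← add_assoc, i3 hs, abs_le]
        constructor <;> linarith [hb m]
    · rw [← add_assoc, i3 (by linarith), h1 m h]; ring

lemma approxSet_nonempty {n : ℕ} (R : SetRearrangement n) {Φ Ψ : En n → En n → ℝ≥0∞}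
    (hΨmeas : Measurable (Function.uncurry Ψ))
    (hΦ0 : ∀ x, Φ x 0 = 0) (hΨ0 : ∀ y, Ψ y 0 = 0)
    (hcap : ∀ A B : Set (En n), MeasurableSet A → MeasurableSet B → A ⊆ B →
      ∀ lam : ℝ, 0 < lam →
        capaGen Ψ lam (R.setMap A) (R.setMap B) ≤ capaGen Φ lam A B)
    {u : En n → ℝ} {Du : En n → En n} (hum : Measurable u) (hw : HasWeakGradient u Du)
    {v : En n → ℝ} (hvm : Measurable v)
    (hv : ∀ t : ℝ, {y | t < v y} = R.setMap {x | t < u x})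
    (hfin : ∫⁻ x, Φ x (Du x) < ⊤) (k : ℕ) :
    (approxSet Ψ v (∫⁻ x, Φ x (Du x)) k).Nonempty := by
  set N : ℝ := k + 1 with hN
  have hNpos : 0 < N := by positivity
  set lam : ℝ := 1 / N with hlamdef
  have hlam : 0 < lam := by positivity
  have hlam1 : lam ≤ 1 := by
    rw [hlamdef, div_le_one hNpos, hN]; linarith [show (0 : ℝ) ≤ k by positivity]
  set m : ℕ := 2 * (k + 1) * (k + 1) with hm
  have hmlam : (m : ℝ) * lam = 2 * N := by
    rw [hm, hlamdef, hN]; push_cast; field_simp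
  have hm0 : (m : ℝ≥0∞) ≠ 0 := by
    exact_mod_cast (show m ≠ 0 by positivity)
  set ε : ℝ≥0∞ := ((k : ℝ≥0∞) + 1)⁻¹ / m with hε
  have hε0 : ε ≠ 0 := by
    rw [hε]
    exact (ENNReal.div_pos (by simp) (ENNReal.natCast_ne_top m)).ne'
  have hexi : ∀ j : ℕ, _ := fun j : ℕ => exists_truncated_competitor R hΦ0 hΨ0 hcap hum hw hvm hv
    hfin (a := -N + j * lam) (b := -N + (j + 1) * lam) (by linarith) hε0
  have hdiff : ∀ j : ℕ, -N + (j + 1) * lam - (-N + j * lam) = lam := fun j => by ring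
  simp only [hdiff] at hexi
  choose w Dw hwD hDm hw1 hw0 hwb hDout hE using hexi
  have hdisj : ∀ i j : ℕ, ∀ s : ℝ, s ∈ Ioc (-N + i * lam) (-N + (i + 1) * lam) →
      s ∈ Ioc (-N + j * lam) (-N + (j + 1) * lam) → i = j := by
    intro i j s hi hj
    by_contra hne
    rcases lt_or_gt_of_ne hne with h | h
    · have : (i : ℝ) + 1 ≤ j := by exact_mod_cast h
      nlinarith [hi.2, hj.1]
    · have : (j : ℝ) + 1 ≤ i := by exact_mod_cast h
      nlinarith [hj.2, hi.1]
  refine ⟨(_, _), HasWeakGradient.const_add_sum (-N) w Dw hwD m,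
    Finset.measurable_fun_sum (Finset.range m) fun j _ => hDm j, fun y => ?_, ?_⟩
  · obtain ⟨s1, s2, s3⟩ := staircase_approx (t₀ := -N) (s := v y) hlam (w := fun j => w j y)
      (fun j => hw1 j y) (fun j => hw0 j y) (fun j => hwb j y) m
    rw [hmlam] at s2 s3
    refine ⟨?_, fun hy => ?_⟩
    · rcases le_or_gt (v y) (-N) with h | h
      · simp only [s1 h]
        rw [abs_neg, abs_of_pos hNpos]
        linarith [neg_abs_le (v y)]
      · rcases le_or_gt (v y) (-N + 2 * N) with h' | h'
        · have h2 := s2 h h'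
          have h3 := abs_add_le (-N + ∑ j ∈ Finset.range m, w j y - v y) (v y)
          rw [sub_add_cancel] at h3
          simp only
          linarith
        · simp only [s3 h']
          rw [show -N + 2 * N = N by ring, abs_of_pos hNpos]
          linarith [le_abs_self (v y)]
    · have := abs_le.1 hy
      exact s2 (by linarith) (by linarith)
  · have hpt : ∀ y, Ψ y (∑ j ∈ Finset.range m, Dw j y) ≤ ∑ j ∈ Finset.range m, Ψ y (Dw j y) := by
      intro y
      by_cases h : ∃ j ∈ Finset.range m, v y ∈ Ioc (-N + j * lam) (-N + (j + 1) * lam)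
      · obtain ⟨j, hj, hjv⟩ := h
        rw [Finset.sum_eq_single_of_mem j hj fun i _ hij => hDout i y fun hi =>
          hij (hdisj i j _ hi hjv)]
        exact Finset.single_le_sum (f := fun j => Ψ y (Dw j y)) (fun _ _ => zero_le) hj
      · rw [Finset.sum_eq_zero fun i hi => hDout i y fun hi' => h ⟨i, hi, hi'⟩, hΨ0]
        exact zero_le
    have hsum : ∑ j ∈ Finset.range m,
        ∫⁻ x in u ⁻¹' Ioo (-N + j * lam) (-N + (j + 1) * lam), Φ x (Du x)
        ≤ ∫⁻ x, Φ x (Du x) := by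
      rw [← lintegral_biUnion_finset]
      · exact setLIntegral_le_lintegral _ _
      · intro i _ j _ hij
        refine Set.disjoint_left.2 fun x hi hj => hij ?_
        exact hdisj i j (u x) (Ioo_subset_Ioc_self hi) (Ioo_subset_Ioc_self hj)
      · exact fun j _ => hum measurableSet_Ioo
    calc ∫⁻ y, Ψ y (∑ j ∈ Finset.range m, Dw j y)
        ≤ ∫⁻ y, ∑ j ∈ Finset.range m, Ψ y (Dw j y) := lintegral_mono hpt
      _ = ∑ j ∈ Finset.range m, ∫⁻ y, Ψ y (Dw j y) :=
          lintegral_finsetSum _ fun j _ => hΨmeas.comp (measurable_id.prodMk (hDm j))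
      _ ≤ ∑ j ∈ Finset.range m,
          ((∫⁻ x in u ⁻¹' Ioo (-N + j * lam) (-N + (j + 1) * lam), Φ x (Du x)) + ε) :=
          Finset.sum_le_sum fun j _ => hE j
      _ ≤ (∫⁻ x, Φ x (Du x)) + ((k : ℝ≥0∞) + 1)⁻¹ := by
          rw [Finset.sum_add_distrib]
          gcongr
          rw [Finset.sum_const, Finset.card_range, nsmul_eq_mul, hε,
            ENNReal.mul_div_cancel hm0 (ENNReal.natCast_ne_top m)]

lemma exists_almost_minimizing_seq {X : Type*} {S : ℕ → Set X} (hS : Antitone S)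
    (hne : ∀ k, (S k).Nonempty) {mid : X → X → X}
    (hmid : ∀ k, ∀ p ∈ S k, ∀ q ∈ S k, mid p q ∈ S k) {J : X → ℝ} {C : ℝ}
    (hJ0 : ∀ p ∈ S 0, 0 ≤ J p) (hJC : ∀ p ∈ S 0, J p ≤ C) {δ : ℕ → ℝ} (hδ : ∀ n, 0 < δ n)
    (hδa : Antitone δ) :
    ∃ x : ℕ → X, (∀ n, x n ∈ S n) ∧
      ∀ n, J (x n) + J (x (n + 1)) - 2 * J (mid (x n) (x (n + 1))) ≤ δ n := by
  have hsub : ∀ k, S k ⊆ S 0 := fun k => hS (Nat.zero_le k)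
  set a : ℕ → ℝ := fun k => sInf (J '' S k) with ha
  have hbdd : ∀ k, BddBelow (J '' S k) := fun k => ⟨0, by
    rintro _ ⟨p, hp, rfl⟩; exact hJ0 p (hsub k hp)⟩
  have hale : ∀ k, ∀ p ∈ S k, a k ≤ J p := fun k p hp => csInf_le (hbdd k) ⟨p, hp, rfl⟩
  have hmono : Monotone a := fun k l hkl =>
    csInf_le_csInf (hbdd k) ((hne l).image J) (image_mono (hS hkl))
  have hub : BddAbove (range a) := ⟨C, by
    rintro _ ⟨k, rfl⟩
    obtain ⟨p, hp⟩ := hne k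
    exact (hale k p hp).trans (hJC p (hsub k hp))⟩
  have hκ : ∀ n, ∃ k, (⨆ k, a k) - δ n / 4 < a k := fun n =>
    exists_lt_of_lt_ciSup (by linarith [hδ n])
  choose κ hκ using hκ
  set K : ℕ → ℕ := fun n => n + ∑ i ∈ Finset.range (n + 1), κ i with hK
  have hKmono : Monotone K := monotone_nat_of_le_succ fun n => by
    simp only [hK, Finset.sum_range_succ _ (n + 1)]; omega
  have hKκ : ∀ n, κ n ≤ K n := fun n => by
    simp only [hK, Finset.sum_range_succ]; omega
  have hKn : ∀ n, n ≤ K n := fun n => Nat.le_add_right _ _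
  have hx : ∀ n, ∃ p ∈ S (K n), J p < a (K n) + δ n / 4 := fun n => by
    obtain ⟨_, ⟨p, hp, rfl⟩, h⟩ := exists_lt_of_csInf_lt ((hne (K n)).image J)
      (show sInf (J '' S (K n)) < a (K n) + δ n / 4 by simp only [ha]; linarith [hδ n])
    exact ⟨p, hp, h⟩
  choose x hxS hxJ using hx
  refine ⟨x, fun n => hS (hKn n) (hxS n), fun n => ?_⟩
  have h1 := hale _ _ (hmid (K n) _ (hxS n) _ (hS (hKmono n.le_succ) (hxS (n + 1))))
  have h2 : a (K (n + 1)) ≤ ⨆ k, a k := le_ciSup hub _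
  have h3 : a (κ n) ≤ a (K n) := hmono (hKκ n)
  linarith [hκ n, hxJ n, hxJ (n + 1), hδ n, hδa n.le_succ]

/-- The strictly convex function `√(1 + ‖ξ‖²)`. -/
def bracket {n : ℕ} (ξ : En n) : ℝ := √(1 + ‖ξ‖ ^ 2)

lemma one_le_bracket {n : ℕ} (ξ : En n) : 1 ≤ bracket ξ :=
  Real.one_le_sqrt.2 (by nlinarith [sq_nonneg ‖ξ‖])

lemma bracket_le {n : ℕ} (ξ : En n) : bracket ξ ≤ 1 + ‖ξ‖ :=
  Real.sqrt_le_iff.2 ⟨by positivity, by nlinarith [norm_nonneg ξ]⟩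

lemma continuous_bracket {n : ℕ} : Continuous (bracket : En n → ℝ) := by
  unfold bracket; fun_prop

lemma mul_sub_le_of_sq_eq {p q m s X Y : ℝ} (hp : 1 ≤ p) (hq : 1 ≤ q) (hm : 1 ≤ m)
    (hp2 : p ^ 2 = 1 + X) (hq2 : q ^ 2 = 1 + Y) (hm2 : m ^ 2 = 1 + (X + 2 * s + Y) / 4)
    (hs : s ^ 2 ≤ X * Y) (hX : 0 ≤ X - 2 * s + Y) :
    0 ≤ p + q - 2 * m ∧
      X - 2 * s + Y ≤ 2 * (p * q) * (p + q) * (p + q - 2 * m) := by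
  have hpq : 0 < p * q := by positivity
  have h1 : X - 2 * s + Y ≤ (p * q) ^ 2 - (1 + s) ^ 2 := by
    rw [mul_pow, hp2, hq2]; linarith
  have h2 : 1 + s ≤ p * q :=
    (le_abs_self _).trans (abs_le_of_sq_le_sq (by linarith) hpq.le)
  have h3 : X - 2 * s + Y ≤ (p * q - (1 + s)) * (2 * (p * q)) := by
    linarith [sq_nonneg (p * q - (1 + s))]
  have h4 : (p + q - 2 * m) * (p + q + 2 * m) = 2 * (p * q - (1 + s)) := by
    linear_combination hp2 + hq2 - 4 * hm2
  have h5 : 0 ≤ p + q - 2 * m :=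
    nonneg_of_mul_nonneg_left (h4 ▸ by linarith) (show 0 < p + q + 2 * m by linarith)
  refine ⟨h5, ?_⟩
  have h6 : p * q - (1 + s) ≤ (p + q - 2 * m) * (p + q) := by
    linarith [mul_nonneg h5 h5]
  calc X - 2 * s + Y ≤ (p * q - (1 + s)) * (2 * (p * q)) := h3
    _ ≤ ((p + q - 2 * m) * (p + q)) * (2 * (p * q)) := by gcongr
    _ = _ := by ring

lemma bracket_midpoint {n : ℕ} (ξ η : En n) :
    0 ≤ bracket ξ + bracket η - 2 * bracket ((2⁻¹ : ℝ) • ξ + (2⁻¹ : ℝ) • η) ∧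
    ‖ξ - η‖ ^ 2 ≤ 2 * (bracket ξ * bracket η) * (bracket ξ + bracket η) *
      (bracket ξ + bracket η - 2 * bracket ((2⁻¹ : ℝ) • ξ + (2⁻¹ : ℝ) • η)) := by
  have hp2 : bracket ξ ^ 2 = 1 + ‖ξ‖ ^ 2 := Real.sq_sqrt (by positivity)
  have hq2 : bracket η ^ 2 = 1 + ‖η‖ ^ 2 := Real.sq_sqrt (by positivity)
  have hm2 : bracket ((2⁻¹ : ℝ) • ξ + (2⁻¹ : ℝ) • η) ^ 2
      = 1 + ‖(2⁻¹ : ℝ) • ξ + (2⁻¹ : ℝ) • η‖ ^ 2 := Real.sq_sqrt (by positivity)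
  have hmid : ‖(2⁻¹ : ℝ) • ξ + (2⁻¹ : ℝ) • η‖ ^ 2
      = (‖ξ‖ ^ 2 + 2 * inner ℝ ξ η + ‖η‖ ^ 2) / 4 := by
    rw [← smul_add, norm_smul, mul_pow, norm_add_sq_real]
    norm_num
    ring
  have hsub := norm_sub_sq_real ξ η
  have hcs : inner ℝ ξ η ^ 2 ≤ ‖ξ‖ ^ 2 * ‖η‖ ^ 2 := by
    rw [← mul_pow]
    exact sq_le_sq' (by linarith [neg_le_of_abs_le (abs_real_inner_le_norm ξ η)])
      (real_inner_le_norm ξ η)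
  rw [hmid] at hm2
  rw [hsub]
  exact mul_sub_le_of_sq_eq (one_le_bracket ξ) (one_le_bracket η) (one_le_bracket _) hp2 hq2 hm2
    hcs (by rw [← hsub]; positivity)

lemma exists_weight_measure {n : ℕ} {C : ℕ → ℝ≥0∞} (hC : ∀ m, C m ≠ ⊤) :
    ∃ ν : Measure (En n), volume ≪ ν ∧ ∀ f : En n → ℝ≥0∞,
      (∀ m : ℕ, ∫⁻ y in Metric.closedBall 0 m, f y ≤ C m) → ∫⁻ y, f y ∂ν ≤ 2 := by
  set c : ℕ → ℝ≥0∞ := fun m => 2⁻¹ ^ m * (C m + 1)⁻¹ with hc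
  have hc0 : ∀ m, c m ≠ 0 := fun m => mul_ne_zero (pow_ne_zero _ (by simp))
    (ENNReal.inv_ne_zero.2 (by simp [hC m]))
  refine ⟨Measure.sum fun m : ℕ => c m • volume.restrict (Metric.closedBall 0 m), ?_, ?_⟩
  · intro s hs
    rw [Measure.sum_apply_eq_zero] at hs
    have hcov : s ⊆ ⋃ m : ℕ, s ∩ Metric.closedBall 0 m := fun x hx => by
      obtain ⟨m, hm⟩ := exists_nat_ge ‖x‖
      exact mem_iUnion.2 ⟨m, hx, by simpa using hm⟩
    refine measure_mono_null hcov (measure_iUnion_null fun m => ?_)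
    have := hs m
    rw [Measure.smul_apply, smul_eq_mul, mul_eq_zero] at this
    rw [← Measure.restrict_apply' Metric.isClosed_closedBall.measurableSet]
    exact this.resolve_left (hc0 m)
  · intro f hf
    rw [lintegral_sum_measure]
    calc ∑' m : ℕ, ∫⁻ y, f y ∂(c m • volume.restrict (Metric.closedBall 0 m))
        ≤ ∑' m : ℕ, (2⁻¹ : ℝ≥0∞) ^ m := by
          refine ENNReal.tsum_le_tsum fun m => ?_
          rw [lintegral_smul_measure, smul_eq_mul]
          calc c m * ∫⁻ y in Metric.closedBall 0 m, f y ≤ c m * (C m + 1) := by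
                gcongr; exact (hf m).trans le_self_add
            _ = 2⁻¹ ^ m := by
                rw [hc, mul_assoc, ENNReal.inv_mul_cancel (by simp) (by simp [hC m]), mul_one]
      _ = 2 := by simp [ENNReal.tsum_geometric, ENNReal.one_sub_inv_two]

lemma ae_exists_bound_of_lintegral_le_geometric {α : Type*} [MeasurableSpace α] {ν : Measure α}
    {f : ℕ → α → ℝ≥0∞} (hf : ∀ n, Measurable (f n)) {C : ℝ≥0∞} (hC : C ≠ ⊤)
    (h : ∀ n, ∫⁻ x, f n x ∂ν ≤ C * 2⁻¹ ^ n) :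
    ∀ᵐ x ∂ν, ∃ A : ℝ, 0 ≤ A ∧ ∀ n, f n x ≤ ENNReal.ofReal A := by
  have hsum : ∫⁻ x, ∑' n, f n x ∂ν ≠ ⊤ := by
    rw [lintegral_tsum fun n => (hf n).aemeasurable]
    refine ne_top_of_le_ne_top ?_ (ENNReal.tsum_le_tsum h)
    rw [ENNReal.tsum_mul_left, ENNReal.tsum_geometric, ENNReal.one_sub_inv_two, inv_inv]
    exact ENNReal.mul_ne_top hC (by simp)
  filter_upwards [ae_lt_top (Measurable.tsum hf) hsum] with x hx
  refine ⟨(∑' n, f n x).toReal, ENNReal.toReal_nonneg, fun n => ?_⟩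
  rw [ENNReal.ofReal_toReal hx.ne]
  exact ENNReal.le_tsum n

lemma cauchySeq_of_bracket_bounds {n : ℕ} {g : ℕ → En n} {A : ℝ} (hA : 0 ≤ A)
    (hp : ∀ k, bracket (g k) ≤ A * 2 ^ k)
    (hd : ∀ k, bracket (g k) + bracket (g (k + 1)) -
      2 * bracket ((2⁻¹ : ℝ) • g k + (2⁻¹ : ℝ) • g (k + 1)) ≤ A * (64 ^ k)⁻¹) :
    CauchySeq g := by
  refine cauchySeq_of_le_geometric (1 / 2) (4 * A ^ 2) (by norm_num) fun k => ?_
  obtain ⟨h0, h1⟩ := bracket_midpoint (g k) (g (k + 1))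
  have hk := one_le_bracket (g k)
  have hk' := one_le_bracket (g (k + 1))
  have hpk := hp (k + 1)
  rw [pow_succ] at hpk
  rw [dist_eq_norm]
  refine (le_abs_self _).trans (abs_le_of_sq_le_sq (h1.trans ?_) (by positivity))
  calc 2 * (bracket (g k) * bracket (g (k + 1))) * (bracket (g k) + bracket (g (k + 1))) *
      (bracket (g k) + bracket (g (k + 1)) -
        2 * bracket ((2⁻¹ : ℝ) • g k + (2⁻¹ : ℝ) • g (k + 1)))
      ≤ 2 * ((A * 2 ^ k) * (A * (2 ^ k * 2))) * (A * 2 ^ k + A * (2 ^ k * 2)) *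
        (A * (64 ^ k)⁻¹) := by
        gcongr
        · exact hp k
        · exact hp k
        · exact hd k
    _ = 12 * A ^ 4 * (1 / 8) ^ k := by
        rw [show (64 : ℝ) ^ k = 2 ^ k * 2 ^ k * 2 ^ k * 8 ^ k by
          rw [← mul_pow, ← mul_pow, ← mul_pow]; norm_num]
        rw [one_div, inv_pow]
        have : (2 : ℝ) ^ k ≠ 0 := by positivity
        have : (8 : ℝ) ^ k ≠ 0 := by positivity
        field_simp
        ring
    _ ≤ 16 * A ^ 4 * (1 / 4) ^ k := by gcongr <;> norm_num
    _ = (4 * A ^ 2 * (1 / 2) ^ k) ^ 2 := by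
        rw [mul_pow, ← pow_mul, mul_comm k 2, pow_mul]; norm_num; ring

lemma LocallyCoercive.exists_setLIntegral_enorm_le {n : ℕ} {Ψ : En n → En n → ℝ≥0∞}
    (hΨ : LocallyCoercive Ψ) {K : Set (En n)} (hK : IsCompact K) :
    ∃ r : ℝ, ∀ g : En n → En n,
      ∫⁻ y in K, ‖g y‖ₑ ≤ ENNReal.ofReal r * volume K + ∫⁻ y, Ψ y (g y) := by
  obtain ⟨r, hr⟩ := hΨ K hK 1
  refine ⟨r, fun g => ?_⟩
  calc ∫⁻ y in K, ‖g y‖ₑ ≤ ∫⁻ y in K, (ENNReal.ofReal r + Ψ y (g y)) := by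
        refine setLIntegral_mono' hK.measurableSet fun y hy => ?_
        rw [← ofReal_norm]
        rcases le_total r ‖g y‖ with h | h
        · have := hr y hy (g y) h
          rw [one_mul] at this
          exact this.trans le_add_self
        · exact (ENNReal.ofReal_le_ofReal h).trans le_self_add
    _ = ENNReal.ofReal r * volume K + ∫⁻ y in K, Ψ y (g y) := by
        rw [lintegral_add_left measurable_const, setLIntegral_const]
    _ ≤ _ := add_le_add_right (setLIntegral_le_lintegral _ _) _

lemma LocallyCoercive.locallyIntegrable {n : ℕ} {Ψ : En n → En n → ℝ≥0∞}
    (hΨ : LocallyCoercive Ψ) {g : En n → En n} (hg : Measurable g)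
    (h : ∫⁻ y, Ψ y (g y) ≠ ⊤) : LocallyIntegrable g volume := by
  refine locallyIntegrable_iff.2 fun K hK => ⟨hg.aestronglyMeasurable, ?_⟩
  obtain ⟨r, hr⟩ := hΨ.exists_setLIntegral_enorm_le hK
  exact (hr g).trans_lt (ENNReal.add_lt_top.2
    ⟨ENNReal.mul_lt_top ENNReal.ofReal_lt_top hK.measure_lt_top, h.lt_top⟩)

lemma LocallyCoercive.exists_eLpNorm_indicator_le {n : ℕ} {Ψ : En n → En n → ℝ≥0∞}
    (hΨ : LocallyCoercive Ψ) {K : Set (En n)} (hK : IsCompact K) {I : ℝ≥0∞} (hI : I ≠ ⊤)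
    {ε : ℝ} (hε : 0 < ε) :
    ∃ C : NNReal, ∀ g : En n → En n, ∫⁻ y, Ψ y (g y) ≤ I →
      eLpNorm ({x | C ≤ ‖g x‖₊}.indicator g) 1 (volume.restrict K) ≤ ENNReal.ofReal ε := by
  obtain ⟨r, hr⟩ := hΨ K hK ((I.toReal + 1) / ε)
  have hI0 : 0 < I.toReal + 1 := by positivity
  refine ⟨r.toNNReal, fun g hg => ?_⟩
  rw [eLpNorm_one_eq_lintegral_enorm]
  have key : ENNReal.ofReal ((I.toReal + 1) / ε) *
      ∫⁻ x in K, ‖{x | r.toNNReal ≤ ‖g x‖₊}.indicator g x‖ₑ ≤ I := by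
    rw [← lintegral_const_mul' _ _ ENNReal.ofReal_ne_top]
    refine le_trans (le_trans (setLIntegral_mono' hK.measurableSet fun y hy => ?_)
      (setLIntegral_le_lintegral K fun y => Ψ y (g y))) hg
    by_cases h : y ∈ {x | r.toNNReal ≤ ‖g x‖₊}
    · rw [indicator_of_mem h, ← ofReal_norm, ← ENNReal.ofReal_mul (by positivity)]
      exact hr y hy _ (Real.toNNReal_le_iff_le_coe.1 h)
    · simp [indicator_of_notMem h]
  have hL : ENNReal.ofReal ((I.toReal + 1) / ε) ≠ 0 := by
    simpa using div_pos hI0 hε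
  refine ((ENNReal.mul_le_iff_le_inv hL ENNReal.ofReal_ne_top).1 key).trans ?_
  rw [← ENNReal.ofReal_inv_of_pos (div_pos hI0 hε), ← ENNReal.ofReal_toReal hI,
    ← ENNReal.ofReal_mul (by positivity), ENNReal.toReal_ofReal ENNReal.toReal_nonneg]
  refine ENNReal.ofReal_le_ofReal ?_
  rw [inv_div, div_mul_eq_mul_div, div_le_iff₀ hI0]
  exact mul_le_mul_of_nonneg_left (by linarith) hε.le

lemma tendsto_setIntegral_norm_sub {n : ℕ} {Ψ : En n → En n → ℝ≥0∞}
    (hΨ : LocallyCoercive Ψ) {I : ℝ≥0∞} (hI : I ≠ ⊤) {g : ℕ → En n → En n} {G : En n → En n}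
    (hg : ∀ k, Measurable (g k)) (hG : Measurable G) (hgI : ∀ k, ∫⁻ y, Ψ y (g k y) ≤ I)
    (hGI : ∫⁻ y, Ψ y (G y) ≤ I)
    (hlim : ∀ᵐ y, Tendsto (fun k => g k y) atTop (𝓝 (G y)))
    {K : Set (En n)} (hK : IsCompact K) :
    Tendsto (fun k => ∫ y in K, ‖g k y - G y‖) atTop (𝓝 0) := by
  have : IsFiniteMeasure (volume.restrict K) := ⟨by simpa using hK.measure_lt_top⟩
  have hGm : MemLp G 1 (volume.restrict K) := memLp_one_iff_integrable.2
    ((hΨ.locallyIntegrable hG (ne_top_of_le_ne_top hI hGI)).integrableOn_isCompact hK)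
  have hui : UnifIntegrable g 1 (volume.restrict K) :=
    unifIntegrable_of le_rfl ENNReal.one_ne_top (fun k => (hg k).aestronglyMeasurable)
      fun ε hε => by
        obtain ⟨C, hC⟩ := hΨ.exists_eLpNorm_indicator_le hK hI hε
        exact ⟨C, fun k => hC _ (hgI k)⟩
  have := tendsto_Lp_finite_of_tendsto_ae le_rfl ENNReal.one_ne_top
    (fun k => (hg k).aestronglyMeasurable) hGm hui (ae_restrict_of_ae hlim)
  have h2 := (ENNReal.continuousAt_toReal ENNReal.zero_ne_top).tendsto.comp this
  refine h2.congr fun k => ?_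
  simp only [Function.comp, eLpNorm_one_eq_lintegral_enorm, Pi.sub_apply]
  exact (integral_norm_eq_lintegral_enorm ((hg k).sub hG).aestronglyMeasurable).symm

lemma lintegral_le_of_ae_tendsto {n : ℕ} {Ψ : En n → En n → ℝ≥0∞}
    (hΨmeas : Measurable (Function.uncurry Ψ)) (hlsc : ∀ y, LowerSemicontinuous (Ψ y))
    {I : ℝ≥0∞} {g : ℕ → En n → En n} {G : En n → En n} (hg : ∀ k, Measurable (g k))
    (hgI : ∀ k : ℕ, ∫⁻ y, Ψ y (g k y) ≤ I + ((k : ℝ≥0∞) + 1)⁻¹)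
    (hlim : ∀ᵐ y, Tendsto (fun k => g k y) atTop (𝓝 (G y))) :
    ∫⁻ y, Ψ y (G y) ≤ I := by
  have hI : Tendsto (fun k : ℕ => I + ((k : ℝ≥0∞) + 1)⁻¹) atTop (𝓝 I) := by
    have h1 : Tendsto (fun k : ℕ => ((k : ℝ≥0∞) + 1)⁻¹) atTop (𝓝 0) := by
      have := (tendsto_add_atTop_iff_nat 1).2 ENNReal.tendsto_inv_nat_nhds_zero
      simpa using this
    simpa using tendsto_const_nhds.add h1
  calc ∫⁻ y, Ψ y (G y) ≤ ∫⁻ y, liminf (fun k => Ψ y (g k y)) atTop := by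
        refine lintegral_mono_ae ?_
        filter_upwards [hlim] with y hy
        exact ((hlsc y).le_liminf (G y)).trans (liminf_le_liminf_of_le (u := Ψ y) hy)
    _ ≤ liminf (fun k => ∫⁻ y, Ψ y (g k y)) atTop :=
        lintegral_liminf_le fun k => hΨmeas.comp (measurable_id.prodMk (hg k))
    _ ≤ liminf (fun k : ℕ => I + ((k : ℝ≥0∞) + 1)⁻¹) atTop :=
        liminf_le_liminf (Eventually.of_forall hgI)
    _ = I := hI.liminf_eq

/-- The weak gradient is closed under pointwise dominated convergence of the functions and local
`L¹` convergence of the gradients. -/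
lemma HasWeakGradient.of_tendsto {n : ℕ} {w : ℕ → En n → ℝ} {g : ℕ → En n → En n}
    {v : En n → ℝ} {G : En n → En n} (h : ∀ k, HasWeakGradient (w k) (g k))
    (hv : LocallyIntegrable v volume) (hG : LocallyIntegrable G volume)
    (hwv : ∀ k y, |w k y| ≤ |v y| + 1) (hw : ∀ y, Tendsto (fun k => w k y) atTop (𝓝 (v y)))
    (hg : ∀ K : Set (En n), IsCompact K →
      Tendsto (fun k => ∫ y in K, ‖g k y - G y‖) atTop (𝓝 0)) :
    HasWeakGradient v G := by
  refine ⟨hv, hG, fun η hη hηc i => ?_⟩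
  have hdη : Continuous fun x => fderiv ℝ η x (EuclideanSpace.single i 1) :=
    (hη.continuous_fderiv (by simp)).clm_apply continuous_const
  have hdηc : HasCompactSupport fun x => fderiv ℝ η x (EuclideanSpace.single i 1) :=
    hηc.fderiv_apply ℝ _
  have hva : LocallyIntegrable (fun x => |v x|) volume := fun x => by
    obtain ⟨s, hs, h⟩ := hv x
    exact ⟨s, hs, h.abs⟩
  have hL : Tendsto (fun k => ∫ x, w k x * fderiv ℝ η x (EuclideanSpace.single i 1)) atTop
      (𝓝 (∫ x, v x * fderiv ℝ η x (EuclideanSpace.single i 1))) := by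
    refine tendsto_integral_of_dominated_convergence
      (fun x => (|v x| + 1) * |fderiv ℝ η x (EuclideanSpace.single i 1)|)
      (fun k => (integrable_mul_test (h k).1 hdη hdηc).1)
      (integrable_mul_test (hva.add (locallyIntegrable_const 1)) hdη.abs hdηc.abs)
      (fun k => Eventually.of_forall fun x => ?_)
      (Eventually.of_forall fun x => (hw x).mul_const _)
    rw [Real.norm_eq_abs, abs_mul]
    gcongr
    exact hwv k x
  have hR : Tendsto (fun k => ∫ x, g k x i * η x) atTop (𝓝 (∫ x, G x i * η x)) := by
    refine tendsto_integral_mul_of_tendsto_setIntegral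
      (fun k => locallyIntegrable_coord (h k).2.1 i) (locallyIntegrable_coord hG i)
      hη.continuous hηc ?_
    refine squeeze_zero (fun k => integral_nonneg fun x => abs_nonneg _) (fun k => ?_)
      (hg _ hηc)
    have h1 : LocallyIntegrable (fun x => g k x - G x) volume := (h k).2.1.sub hG
    refine integral_mono
      ((locallyIntegrable_coord h1 i).integrableOn_isCompact hηc).norm
      (h1.integrableOn_isCompact hηc).norm fun x => ?_
    exact PiLp.norm_apply_le (g k x - G x) i
  exact tendsto_nhds_unique hL
    (hR.neg.congr fun k => ((h k).2.2 η hη hηc i).symm)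

lemma exists_approxSet_seq_tendsto_ae {n : ℕ} {Ψ : En n → En n → ℝ≥0∞}
    (hΨmeas : Measurable (Function.uncurry Ψ)) (hΨ : LocallyCoercive Ψ)
    (hconv : ∀ (y : En n) (ξ η : En n) (a b : ℝ), 0 ≤ a → 0 ≤ b → a + b = 1 →
      Ψ y (a • ξ + b • η) ≤ ENNReal.ofReal a * Ψ y ξ + ENNReal.ofReal b * Ψ y η)
    {v : En n → ℝ} {I : ℝ≥0∞} (hI : I ≠ ⊤) (hne : ∀ k, (approxSet Ψ v I k).Nonempty) :
    ∃ (x : ℕ → (En n → ℝ) × (En n → En n)) (G : En n → En n),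
      (∀ k, x k ∈ approxSet Ψ v I k) ∧ Measurable G ∧
        ∀ᵐ y, Tendsto (fun k => (x k).2 y) atTop (𝓝 (G y)) := by
  choose r hr using fun m : ℕ =>
    hΨ.exists_setLIntegral_enorm_le (isCompact_closedBall (0 : En n) m)
  obtain ⟨ν, hν, hνle⟩ := exists_weight_measure (n := n)
    (C := fun m : ℕ => volume (Metric.closedBall (0 : En n) m) +
      (ENNReal.ofReal (r m) * volume (Metric.closedBall (0 : En n) m) + (I + 1))) fun m => by
    have := (isCompact_closedBall (0 : En n) m).measure_lt_top (μ := volume)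
    finiteness
  have hanti := approxSet_antitone Ψ v I
  have hmeas : ∀ p ∈ approxSet Ψ v I 0, Measurable p.2 := fun p hp => hp.2.1
  have hL : ∀ p ∈ approxSet Ψ v I 0, ∫⁻ y, ENNReal.ofReal (bracket (p.2 y)) ∂ν ≤ 2 := by
    refine fun p hp => hνle _ fun m => ?_
    calc ∫⁻ y in Metric.closedBall 0 m, ENNReal.ofReal (bracket (p.2 y))
        ≤ ∫⁻ y in Metric.closedBall 0 m, (1 + ‖p.2 y‖ₑ) := by
          refine lintegral_mono fun y => ?_
          rw [← ofReal_norm, ← ENNReal.ofReal_one, ← ENNReal.ofReal_add zero_le_one (norm_nonneg _)]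
          exact ENNReal.ofReal_le_ofReal (bracket_le _)
      _ = volume (Metric.closedBall (0 : En n) m)
          + ∫⁻ y in Metric.closedBall 0 m, ‖p.2 y‖ₑ := by
          rw [lintegral_add_left measurable_const, setLIntegral_const, one_mul]
      _ ≤ _ := by
          gcongr
          refine (hr m p.2).trans (add_le_add_right ?_ _)
          simpa using hp.2.2.2
  have hLtop : ∀ p ∈ approxSet Ψ v I 0, ∫⁻ y, ENNReal.ofReal (bracket (p.2 y)) ∂ν ≠ ⊤ :=
    fun p hp => ne_top_of_le_ne_top (by simp) (hL p hp)
  obtain ⟨x, hxS, hx⟩ := exists_almost_minimizing_seq hanti hne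
    (mid := fun p q => (2⁻¹ : ℝ) • p + (2⁻¹ : ℝ) • q)
    (fun k p hp q hq => midpoint_mem_approxSet hΨmeas hconv hp hq)
    (J := fun p => (∫⁻ y, ENNReal.ofReal (bracket (p.2 y)) ∂ν).toReal) (C := 2)
    (fun p _ => ENNReal.toReal_nonneg)
    (fun p hp => ENNReal.toReal_le_of_le_ofReal (by norm_num) (by simpa using hL p hp))
    (δ := fun k => (128⁻¹ : ℝ) ^ k) (fun k => by positivity)
    (pow_right_anti₀ (by norm_num) (by norm_num))
  have hx0 : ∀ k, x k ∈ approxSet Ψ v I 0 := fun k => hanti (Nat.zero_le k) (hxS k)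
  have hxm : ∀ k, Measurable (x k).2 := fun k => hmeas _ (hx0 k)
  have hbm : ∀ {g : En n → En n}, Measurable g →
      Measurable fun y => ENNReal.ofReal (bracket (g y)) := fun hg =>
    (continuous_bracket.measurable.comp hg).ennreal_ofReal
  set d : ℕ → En n → ℝ := fun k y => bracket ((x k).2 y) + bracket ((x (k + 1)).2 y) -
    2 * bracket ((2⁻¹ : ℝ) • (x k).2 y + (2⁻¹ : ℝ) • (x (k + 1)).2 y) with hd
  have hdm : ∀ k, Measurable (d k) := fun k => by
    have := fun k => continuous_bracket.measurable.comp (hxm k)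
    have h2 := continuous_bracket.measurable.comp
      (((hxm k).const_smul (2⁻¹ : ℝ)).add ((hxm (k + 1)).const_smul (2⁻¹ : ℝ)))
    exact ((this k).add (this (k + 1))).sub (h2.const_mul 2)
  have hd0 : ∀ k y, 0 ≤ d k y := fun k y => (bracket_midpoint _ _).1
  have hdI : ∀ k, ∫⁻ y, ENNReal.ofReal (d k y) ∂ν ≤ ENNReal.ofReal ((128⁻¹ : ℝ) ^ k) := by
    intro k
    have hmid := hLtop _ (midpoint_mem_approxSet hΨmeas hconv (hx0 k) (hx0 (k + 1)))
    have hmm := hmeas _ (midpoint_mem_approxSet hΨmeas hconv (hx0 k) (hx0 (k + 1)))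
    have hid : ∫⁻ y, ENNReal.ofReal (d k y) ∂ν +
        2 * ∫⁻ y, ENNReal.ofReal
          (bracket (((2⁻¹ : ℝ) • x k + (2⁻¹ : ℝ) • x (k + 1)).2 y)) ∂ν =
        ∫⁻ y, ENNReal.ofReal (bracket ((x k).2 y)) ∂ν +
        ∫⁻ y, ENNReal.ofReal (bracket ((x (k + 1)).2 y)) ∂ν := by
      rw [← lintegral_const_mul _ (hbm hmm), ← lintegral_add_left (hdm k).ennreal_ofReal,
        ← lintegral_add_left (hbm (hxm k))]
      refine lintegral_congr fun y => ?_
      have hb : ∀ ξ : En n, 0 ≤ bracket ξ := fun ξ => zero_le_one.trans (one_le_bracket ξ)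
      have hb2 : ∀ ξ : En n, 2 * ENNReal.ofReal (bracket ξ) = ENNReal.ofReal (2 * bracket ξ) :=
        fun ξ => by rw [ENNReal.ofReal_mul zero_le_two, ENNReal.ofReal_ofNat]
      rw [hb2, ← ENNReal.ofReal_add (hd0 k y) (mul_nonneg zero_le_two (hb _)),
        ← ENNReal.ofReal_add (hb _) (hb _)]
      simp [hd]
    have hfin : ∫⁻ y, ENNReal.ofReal (d k y) ∂ν ≠ ⊤ :=
      ne_top_of_le_ne_top (ENNReal.add_ne_top.2 ⟨hLtop _ (hx0 k), hLtop _ (hx0 (k + 1))⟩)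
        (le_self_add.trans_eq hid)
    have hreal := congrArg ENNReal.toReal hid
    rw [ENNReal.toReal_add hfin (ENNReal.mul_ne_top (by simp) hmid), ENNReal.toReal_mul,
      ENNReal.toReal_add (hLtop _ (hx0 k)) (hLtop _ (hx0 (k + 1))), ENNReal.toReal_ofNat] at hreal
    rw [← ENNReal.ofReal_toReal hfin]
    refine ENNReal.ofReal_le_ofReal ?_
    linarith [hx k]
  have hae := ae_exists_bound_of_lintegral_le_geometric (ν := ν) (C := 3)
    (f := fun k y => ENNReal.ofReal (2⁻¹ ^ k) * ENNReal.ofReal (bracket ((x k).2 y)) +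
      ENNReal.ofReal (64 ^ k) * ENNReal.ofReal (d k y))
    (fun k => ((hbm (hxm k)).const_mul _).add ((hdm k).ennreal_ofReal.const_mul _))
    (by simp) fun k => by
      rw [lintegral_add_left ((hbm (hxm k)).const_mul _), lintegral_const_mul _ (hbm (hxm k)),
        lintegral_const_mul _ (hdm k).ennreal_ofReal]
      have h2 : ENNReal.ofReal (2⁻¹ ^ k) = 2⁻¹ ^ k := by
        rw [ENNReal.ofReal_pow (by norm_num), ENNReal.ofReal_inv_of_pos two_pos,
          ENNReal.ofReal_ofNat]
      calc _ ≤ ENNReal.ofReal (2⁻¹ ^ k) * 2 +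
            ENNReal.ofReal (64 ^ k) * ENNReal.ofReal (128⁻¹ ^ k) := by
            gcongr
            · exact hL _ (hx0 k)
            · exact hdI k
        _ = 3 * 2⁻¹ ^ k := by
            rw [← ENNReal.ofReal_mul (by positivity), ← mul_pow,
              show (64 * 128⁻¹ : ℝ) = 2⁻¹ by norm_num, h2]
            ring
  have hconvg : ∀ᵐ y, ∃ l, Tendsto (fun k => (x k).2 y) atTop (𝓝 l) := by
    filter_upwards [hν.ae_le hae] with y ⟨A, hA, hy⟩
    refine cauchySeq_tendsto_of_complete (cauchySeq_of_bracket_bounds hA (fun k => ?_) fun k => ?_)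
    · have h := le_self_add.trans (hy k)
      rw [← ENNReal.ofReal_mul (by positivity), ENNReal.ofReal_le_ofReal_iff hA, inv_pow,
        inv_mul_le_iff₀ (by positivity)] at h
      linarith
    · have h := le_add_self.trans (hy k)
      rw [← ENNReal.ofReal_mul (by positivity), ENNReal.ofReal_le_ofReal_iff hA] at h
      rwa [← div_eq_mul_inv, le_div_iff₀' (by positivity)]
  obtain ⟨G, hG, hlim⟩ :=
    measurable_limit_of_tendsto_metrizable_ae (fun k => (hxm k).aemeasurable) hconvg
  exact ⟨x, G, hxS, hG, hlim⟩

lemma SetRearrangement.levelSet_of_fnMap_eq {n : ℕ} (R : SetRearrangement n) {u v : En n → ℝ}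
    (hu : Measurable u) (hv : ∀ y, R.fnMap (fun x => (u x : EReal)) y = (v y : EReal)) (t : ℝ) :
    {y | t < v y} = R.setMap {x | t < u x} := by
  have := R.levelSet_fnMap (fun x => (u x : EReal)) hu.coe_real_ereal t
  simpa only [hv, EReal.coe_lt_coe_iff] using this

/-- sufficient condition for the Pólya–Szegő inequality. -/
theorem statement7 {n : ℕ} (R : SetRearrangement n)
    (Φ Ψ : En n → En n → ℝ≥0∞)
    (hΦmeas : Measurable (Function.uncurry Φ)) (hΨmeas : Measurable (Function.uncurry Ψ))
    (hΦ0 : ∀ x, Φ x 0 = 0) (hΨ0 : ∀ y, Ψ y 0 = 0)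
    (hcoercive : LocallyCoercive Ψ)
    (hconv : ∀ (y : En n) (ξ η : En n) (a b : ℝ), 0 ≤ a → 0 ≤ b → a + b = 1 →
      Ψ y (a • ξ + b • η) ≤ ENNReal.ofReal a * Ψ y ξ + ENNReal.ofReal b * Ψ y η)
    (hlsc : ∀ y : En n, LowerSemicontinuous (Ψ y))
    (hcap : ∀ A B : Set (En n), MeasurableSet A → MeasurableSet B → A ⊆ B →
      ∀ lam : ℝ, 0 < lam →
        capaGen Ψ lam (R.setMap A) (R.setMap B) ≤ capaGen Φ lam A B)
    (u : En n → ℝ) (Du : En n → En n) (hum : Measurable u) (hw : HasWeakGradient u Du)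
    (hloc : ∃ v : En n → ℝ, (∀ y, R.fnMap (fun x => (u x : EReal)) y = (v y : EReal)) ∧
      LocallyIntegrable v volume)
    (hfin : ∫⁻ x, Φ x (Du x) < ⊤) :
    ∃ (v : En n → ℝ) (Dv : En n → En n),
      (∀ y, R.fnMap (fun x => (u x : EReal)) y = (v y : EReal)) ∧
      HasWeakGradient v Dv ∧
      ∫⁻ y, Ψ y (Dv y) ≤ ∫⁻ x, Φ x (Du x) := by
  obtain ⟨v, hvu, hvloc⟩ := hloc
  have hlev := R.levelSet_of_fnMap_eq hum hvu
  have hvm : Measurable v := measurable_of_Ioi fun t => by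
    change MeasurableSet {y | t < v y}
    rw [hlev t]
    exact R.measurableSet_setMap _ (measurableSet_lt measurable_const hum)
  set I := ∫⁻ x, Φ x (Du x)
  obtain ⟨x, G, hxS, hG, hlim⟩ := exists_approxSet_seq_tendsto_ae hΨmeas hcoercive hconv hfin.ne
    (approxSet_nonempty R hΨmeas hΦ0 hΨ0 hcap hum hw hvm hlev hfin)
  have hGI : ∫⁻ y, Ψ y (G y) ≤ I :=
    lintegral_le_of_ae_tendsto hΨmeas hlsc (fun k => (hxS k).2.1) (fun k => (hxS k).2.2.2) hlim
  have hxI : ∀ k, ∫⁻ y, Ψ y ((x k).2 y) ≤ I + 1 := fun k =>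
    (hxS k).2.2.2.trans (add_le_add_right (ENNReal.inv_le_one.2 le_add_self) _)
  refine ⟨v, G, hvu, HasWeakGradient.of_tendsto (fun k => (hxS k).1) hvloc
    (hcoercive.locallyIntegrable hG (hGI.trans_lt hfin).ne) (fun k y => ((hxS k).2.2.1 y).1)
    (fun y => ?_) (fun K hK => tendsto_setIntegral_norm_sub hcoercive
      (ENNReal.add_ne_top.2 ⟨hfin.ne, ENNReal.one_ne_top⟩) (fun k => (hxS k).2.1) hG hxI
      (hGI.trans le_self_add) hlim hK), hGI⟩
  obtain ⟨N, hN⟩ := exists_nat_ge |v y|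
  rw [tendsto_iff_norm_sub_tendsto_zero]
  refine squeeze_zero' (Eventually.of_forall fun k => norm_nonneg _) ?_
    tendsto_one_div_add_atTop_nhds_zero_nat
  filter_upwards [eventually_ge_atTop N] with k hk
  exact ((hxS k).2.2.1 y).2 (hN.trans (by exact_mod_cast hk))
end
end

section
/- (Lower semicontinuity lemma, Euclidean version.) Let ψ : ℝ^n × ℝ^n → [0, +∞] be Borel measurable with ψ(y, 0) = 0 for all y, locally coercive, and such that for every y ∈ ℝ^n the map ξ ↦ ψ(y, ξ) is convex and lower semicontinuous. If a sequence (v_k) in W^{1,1}_loc(ℝ^n) converges to v : ℝ^n → ℝ̄ in L¹_loc(ℝ^n) and liminf_{k→∞} ∫_{ℝ^n} ψ(y, dv_k(y)) dy < ∞, then v ∈ W^{1,1}_loc(ℝ^n) and ∫_{ℝ^n} ψ(y, dv(y)) dy ≤ liminf_{k→∞} ∫_{ℝ^n} ψ(y, dv_k(y)) dy. -/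
open MeasureTheory Set Filter Topology ENNReal

noncomputable section

/-- In a decreasing sequence of nonempty convex sets on which countably many linear maps to
inner product spaces are bounded, one can select points whose images are all Cauchy. -/
theorem exists_mem_forall_cauchySeq_of_convex {E : Type*} [AddCommGroup E] [Module ℝ E]
    {H : ℕ → Type*} [∀ m, NormedAddCommGroup (H m)] [∀ m, InnerProductSpace ℝ (H m)]
    (L : ∀ m, E →ₗ[ℝ] H m) (b : ℕ → ℝ) (C : ℕ → Set E) (hanti : Antitone C)
    (hconv : ∀ j, Convex ℝ (C j)) (hne : ∀ j, (C j).Nonempty)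
    (hb : ∀ x ∈ C 0, ∀ m, ‖L m x‖ ≤ b m) :
    ∃ y : ℕ → E, (∀ j, y j ∈ C j) ∧ ∀ m, CauchySeq fun j => L m (y j) := by
  set c : ℕ → ℝ := fun m => (1 / 2) ^ m / (1 + b m ^ 2) with hc
  have hcpos : ∀ m, 0 < c m := fun m => by positivity
  have hcb : ∀ m, c m * b m ^ 2 ≤ (1 / 2) ^ m := fun m => by
    rw [hc, div_mul_eq_mul_div, div_le_iff₀ (by positivity)]
    nlinarith [pow_pos (one_half_pos (α := ℝ)) m]
  have hmem : ∀ {j x}, x ∈ C j → x ∈ C 0 := fun h => hanti (Nat.zero_le _) h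
  have hterm : ∀ x ∈ C 0, ∀ m, c m * ‖L m x‖ ^ 2 ≤ (1 / 2) ^ m := fun x hx m =>
    (mul_le_mul_of_nonneg_left (pow_le_pow_left₀ (norm_nonneg _) (hb x hx m) 2)
      (hcpos m).le).trans (hcb m)
  have hterm0 : ∀ x m, 0 ≤ c m * ‖L m x‖ ^ 2 := fun x m => by have := hcpos m; positivity
  have hsum : ∀ x ∈ C 0, Summable fun m => c m * ‖L m x‖ ^ 2 := fun x hx =>
    Summable.of_nonneg_of_le (hterm0 x) (hterm x hx) summable_geometric_two
  set Q : E → ℝ := fun x => ∑' m, c m * ‖L m x‖ ^ 2 with hQ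
  have hQ0 : ∀ x, 0 ≤ Q x := fun x => tsum_nonneg (hterm0 x)
  have hQ2 : ∀ x ∈ C 0, Q x ≤ 2 := fun x hx =>
    ((hsum x hx).tsum_le_tsum (hterm x hx) summable_geometric_two).trans tsum_geometric_two.le
  have hpar : ∀ x ∈ C 0, ∀ y ∈ C 0, ∀ m,
      c m * ‖L m x - L m y‖ ^ 2 ≤ 2 * Q x + 2 * Q y - 4 * Q ((1 / 2 : ℝ) • x + (1 / 2 : ℝ) • y) := by
    intro x hx y hy m
    have hz : (1 / 2 : ℝ) • x + (1 / 2 : ℝ) • y ∈ C 0 :=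
      hconv 0 hx hy (by norm_num) (by norm_num) (by norm_num)
    have hs := (((hsum x hx).hasSum.mul_left 2).add ((hsum y hy).hasSum.mul_left 2)).sub
      ((hsum _ hz).hasSum.mul_left 4)
    have key : ∀ i, 2 * (c i * ‖L i x‖ ^ 2) + 2 * (c i * ‖L i y‖ ^ 2) -
        4 * (c i * ‖L i ((1 / 2 : ℝ) • x + (1 / 2 : ℝ) • y)‖ ^ 2) =
        c i * ‖L i x - L i y‖ ^ 2 := by
      intro i
      have h1 := parallelogram_law_with_norm ℝ (L i x) (L i y)
      have h2 : L i ((1 / 2 : ℝ) • x + (1 / 2 : ℝ) • y) = (1 / 2 : ℝ) • (L i x + L i y) := by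
        simp
      rw [h2, norm_smul, Real.norm_of_nonneg (by norm_num)]
      linear_combination -c i * h1
    simp only [key] at hs
    exact le_hasSum hs m fun i _ => by have := hcpos i; positivity
  set d : ℕ → ℝ := fun j => sInf (Q '' C j) with hd
  have hbdd : ∀ j, BddBelow (Q '' C j) := fun j =>
    ⟨0, by rintro _ ⟨x, _, rfl⟩; exact hQ0 x⟩
  have hdmono : Monotone d := fun i j hij =>
    csInf_le_csInf (hbdd i) ((hne j).image Q) (image_mono (hanti hij))
  have hdle : ∀ j, ∀ x ∈ C j, d j ≤ Q x := fun j x hx => csInf_le (hbdd j) ⟨x, hx, rfl⟩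
  have hdbdd : BddAbove (range d) := by
    refine ⟨2, ?_⟩
    rintro _ ⟨j, rfl⟩
    obtain ⟨x, hx⟩ := hne j
    exact (hdle j x hx).trans (hQ2 x (hmem hx))
  have hex : ∀ j, ∃ x ∈ C j, Q x < d j + 1 / ((j : ℝ) + 1) := by
    intro j
    obtain ⟨_, ⟨x, hx, rfl⟩, hlt⟩ := exists_lt_of_csInf_lt ((hne j).image Q)
      (lt_add_of_pos_right (d j) (Nat.one_div_pos_of_nat (α := ℝ) (n := j)))
    exact ⟨x, hx, hlt⟩
  choose y hy hyQ using hex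
  refine ⟨y, hy, fun m => ?_⟩
  set β : ℕ → ℝ := fun i => 2 * ((⨆ j, d j) - d i) + 4 * (1 / ((i : ℝ) + 1)) with hβ
  have hβlim : Tendsto β atTop (𝓝 0) := by
    have h1 := ((tendsto_atTop_ciSup hdmono hdbdd).const_sub (⨆ j, d j)).const_mul 2
    have h2 := (tendsto_one_div_add_atTop_nhds_zero_nat (𝕜 := ℝ)).const_mul 4
    simpa [hβ] using h1.add h2
  have hlim : Tendsto (fun i => √(β i / c m)) atTop (𝓝 0) := by
    simpa using (hβlim.div_const (c m)).sqrt
  refine cauchySeq_of_le_tendsto_0' _ (fun i k hik => ?_) hlim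
  rw [dist_eq_norm]
  refine Real.le_sqrt_of_sq_le ?_
  rw [le_div_iff₀' (hcpos m)]
  have hyk : y k ∈ C i := hanti hik (hy k)
  have h1 := hpar _ (hmem (hy i)) _ (hmem hyk) m
  have h2 := hdle i _ (hconv i (hy i) hyk (by norm_num : (0 : ℝ) ≤ 1 / 2)
    (by norm_num : (0 : ℝ) ≤ 1 / 2) (by norm_num))
  have h3 := hyQ i
  have h4 := hyQ k
  have h5 : d k ≤ ⨆ j, d j := le_ciSup hdbdd k
  have h6 : 1 / ((k : ℝ) + 1) ≤ 1 / ((i : ℝ) + 1) := Nat.one_div_le_one_div hik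
  rw [hβ]
  linarith

theorem lintegral_le_of_ae_le_convex_combination {α : Type*} [MeasurableSpace α] {μ : Measure α}
    {f f₁ f₂ : α → ℝ≥0∞} {a b : ℝ} {S : ℝ≥0∞} (ha : 0 ≤ a) (hb : 0 ≤ b) (hab : a + b = 1)
    (hf₁ : AEMeasurable f₁ μ)
    (hle : ∀ᵐ x ∂μ, f x ≤ ENNReal.ofReal a * f₁ x + ENNReal.ofReal b * f₂ x)
    (h₁ : ∫⁻ x, f₁ x ∂μ ≤ S) (h₂ : ∫⁻ x, f₂ x ∂μ ≤ S) : ∫⁻ x, f x ∂μ ≤ S := by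
  calc ∫⁻ x, f x ∂μ
      ≤ ∫⁻ x, (ENNReal.ofReal a * f₁ x + ENNReal.ofReal b * f₂ x) ∂μ := lintegral_mono_ae hle
    _ = ENNReal.ofReal a * ∫⁻ x, f₁ x ∂μ + ENNReal.ofReal b * ∫⁻ x, f₂ x ∂μ := by
      rw [lintegral_add_left' (hf₁.const_mul _), lintegral_const_mul' _ _ ofReal_ne_top,
        lintegral_const_mul' _ _ ofReal_ne_top]
    _ ≤ ENNReal.ofReal a * S + ENNReal.ofReal b * S := by gcongr
    _ = S := by rw [← add_mul, ← ofReal_add ha hb, hab, ofReal_one, one_mul]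

theorem enorm_convex_combination_sub_le {F : Type*} [NormedAddCommGroup F] [NormedSpace ℝ F]
    {a b : ℝ} (ha : 0 ≤ a) (hb : 0 ≤ b) (x₁ x₂ y₁ y₂ : F) :
    ‖(a • x₁ + b • x₂) - (a • y₁ + b • y₂)‖ₑ ≤
      ENNReal.ofReal a * ‖x₁ - y₁‖ₑ + ENNReal.ofReal b * ‖x₂ - y₂‖ₑ := by
  have h : (a • x₁ + b • x₂) - (a • y₁ + b • y₂) = a • (x₁ - y₁) + b • (x₂ - y₂) := by
    module
  rw [h]
  refine (enorm_add_le _ _).trans_eq ?_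
  rw [enorm_smul, enorm_smul, Real.enorm_of_nonneg ha, Real.enorm_of_nonneg hb]

theorem HasWeakGradient.convex_combination {n : ℕ} {u₁ u₂ : En n → ℝ} {D₁ D₂ : En n → En n}
    (h₁ : HasWeakGradient u₁ D₁) (h₂ : HasWeakGradient u₂ D₂) (a b : ℝ) :
    HasWeakGradient (a • u₁ + b • u₂) (a • D₁ + b • D₂) := by
  obtain ⟨hu₁, hD₁, hw₁⟩ := h₁
  obtain ⟨hu₂, hD₂, hw₂⟩ := h₂
  refine ⟨(hu₁.smul a).add (hu₂.smul b), (hD₁.smul a).add (hD₂.smul b), fun φ hφ hφc i => ?_⟩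
  have hcont : Continuous fun x => fderiv ℝ φ x (EuclideanSpace.single i 1) :=
    (hφ.continuous_fderiv (by simp)).clm_apply continuous_const
  have hsupp : HasCompactSupport fun x => fderiv ℝ φ x (EuclideanSpace.single i 1) :=
    hφc.fderiv_apply (𝕜 := ℝ) _
  have iu : ∀ {u : En n → ℝ}, LocallyIntegrable u volume →
      Integrable fun x => u x * fderiv ℝ φ x (EuclideanSpace.single i 1) := fun hu =>
    hu.integrable_smul_right_of_hasCompactSupport hcont hsupp
  have iD : ∀ {D : En n → En n}, LocallyIntegrable D volume →
      Integrable fun x => D x i * φ x := fun {D} hD => by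
    have h := (EuclideanSpace.proj (𝕜 := ℝ) i).integrable_comp
      (hD.integrable_smul_left_of_hasCompactSupport hφ.continuous hφc)
    refine h.congr (Eventually.of_forall fun x => ?_)
    simp [mul_comm]
  have e₁ : (fun x => (a • u₁ + b • u₂) x * fderiv ℝ φ x (EuclideanSpace.single i 1)) =
      fun x => a * (u₁ x * fderiv ℝ φ x (EuclideanSpace.single i 1)) +
        b * (u₂ x * fderiv ℝ φ x (EuclideanSpace.single i 1)) := by
    ext x; simp; ring
  have e₂ : (fun x => (a • D₁ + b • D₂) x i * φ x) =
      fun x => a * (D₁ x i * φ x) + b * (D₂ x i * φ x) := by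
    ext x; simp; ring
  rw [e₁, e₂, integral_add ((iu hu₁).const_mul a) ((iu hu₂).const_mul b),
    integral_add ((iD hD₁).const_mul a) ((iD hD₂).const_mul b)]
  simp only [integral_const_mul]
  rw [hw₁ φ hφ hφc i, hw₂ φ hφ hφc i]
  ring

theorem locallyIntegrable_of_lintegral_sub_lt_top {n : ℕ} {F : Type*} [NormedAddCommGroup F]
    {g : ℕ → En n → F} {f : En n → F} (hf : AEStronglyMeasurable f volume)
    (hg : ∀ l, LocallyIntegrable (g l) volume)
    (h : ∀ R : ℕ, ∃ l, ∫⁻ x in Metric.closedBall 0 (R : ℝ), ‖g l x - f x‖ₑ < ⊤) :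
    LocallyIntegrable f volume := by
  intro x
  obtain ⟨R, hR⟩ := exists_nat_gt ‖x‖
  refine ⟨Metric.closedBall 0 (R : ℝ), Metric.closedBall_mem_nhds_of_mem (by simpa using hR), ?_⟩
  obtain ⟨l, hl⟩ := h R
  have hgi : IntegrableOn (g l) (Metric.closedBall 0 (R : ℝ)) volume :=
    (hg l).integrableOn_isCompact (isCompact_closedBall _ _)
  have hd : IntegrableOn (fun x => g l x - f x) (Metric.closedBall 0 (R : ℝ)) volume :=
    ⟨(hg l).aestronglyMeasurable.restrict.sub hf.restrict, hl⟩
  have := Integrable.sub hgi hd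
  simpa [IntegrableOn, Pi.sub_def] using this

theorem tendsto_integral_mul_of_tendsto_lintegral_sub {n : ℕ} {g : ℕ → En n → ℝ} {f : En n → ℝ}
    (hf : LocallyIntegrable f volume) (hg : ∀ l, LocallyIntegrable (g l) volume)
    (h : ∀ R : ℕ, Tendsto (fun l => ∫⁻ x in Metric.closedBall 0 (R : ℝ), ‖g l x - f x‖ₑ)
      atTop (𝓝 0))
    {φ : En n → ℝ} (hφ : Continuous φ) (hφc : HasCompactSupport φ) :
    Tendsto (fun l => ∫ x, g l x * φ x) atTop (𝓝 (∫ x, f x * φ x)) := by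
  obtain ⟨M, hM⟩ := hφc.exists_bound_of_continuous hφ
  obtain ⟨r, hr⟩ := hφc.isCompact.isBounded.subset_closedBall 0
  obtain ⟨R, hR⟩ := exists_nat_ge r
  refine tendsto_integral_of_L1 _
    (hf.integrable_smul_right_of_hasCompactSupport hφ hφc).aestronglyMeasurable
    (Eventually.of_forall fun l => (hg l).integrable_smul_right_of_hasCompactSupport hφ hφc) ?_
  refine tendsto_of_tendsto_of_tendsto_of_le_of_le tendsto_const_nhds
    (h := fun l => ENNReal.ofReal M * ∫⁻ x in Metric.closedBall 0 (R : ℝ), ‖g l x - f x‖ₑ)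
    (by simpa using ENNReal.Tendsto.const_mul (h R) (Or.inr ofReal_ne_top)) (fun _ => zero_le)
    fun l => ?_
  dsimp only
  rw [← lintegral_const_mul' _ _ ofReal_ne_top,
    ← lintegral_indicator Metric.isClosed_closedBall.measurableSet]
  refine lintegral_mono fun x => ?_
  by_cases hx : x ∈ Metric.closedBall (0 : En n) (R : ℝ)
  · rw [indicator_of_mem hx, smul_eq_mul, ← sub_mul, enorm_mul, mul_comm]
    gcongr
    rw [← ofReal_norm]
    exact ofReal_le_ofReal (hM x)
  · have : φ x = 0 := image_eq_zero_of_notMem_tsupport fun h' =>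
      hx (Metric.closedBall_subset_closedBall hR (hr h'))
    simp [this]

theorem exists_lp_norm_le_and_lintegral_sub_le {n : ℕ} {Ψ : En n → En n → ℝ≥0∞} {K : Set (En n)}
    (hK : IsCompact K) {C r : ℝ} (hC : 0 < C)
    (hr : ∀ x ∈ K, ∀ ξ : En n, r ≤ ‖ξ‖ → ENNReal.ofReal (C * ‖ξ‖) ≤ Ψ x ξ)
    {G : En n → En n} (hG : AEStronglyMeasurable G volume) {M : ℝ≥0∞}
    (hM : ∫⁻ x, Ψ x (G x) ≤ M) :
    ∃ T : Lp (En n) 2 (volume.restrict K),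
      ‖T‖ ≤ (volume.restrict K).real univ ^ (2 : ℝ≥0∞).toReal⁻¹ * max r 0 ∧
      ∫⁻ x in K, ‖G x - T x‖ₑ ≤ M / ENNReal.ofReal C := by
  have : IsFiniteMeasure (volume.restrict K) := ⟨by simpa using hK.measure_lt_top⟩
  set τ : En n → En n := fun ξ => if ‖ξ‖ < r then ξ else 0 with hτ
  have hτm : Measurable τ :=
    Measurable.ite (measurableSet_lt measurable_norm measurable_const) measurable_id
      measurable_const
  have hτb : ∀ ξ, ‖τ ξ‖ ≤ max r 0 := fun ξ => by
    simp only [hτ]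
    split_ifs with h
    · exact le_max_of_le_left h.le
    · simp
  have hmeas : AEStronglyMeasurable (fun x => τ (G x)) (volume.restrict K) :=
    (hτm.comp_aemeasurable hG.aemeasurable.restrict).aestronglyMeasurable
  have hLp : MemLp (fun x => τ (G x)) 2 (volume.restrict K) :=
    MemLp.of_bound hmeas _ (Eventually.of_forall fun x => hτb _)
  refine ⟨hLp.toLp, Lp.norm_le_of_ae_bound (le_max_right _ _) ?_, ?_⟩
  · filter_upwards [hLp.coeFn_toLp] with x hx
    rw [hx]
    exact hτb _
  · rw [ENNReal.le_div_iff_mul_le (Or.inl (by simpa using hC)) (Or.inl ofReal_ne_top), mul_comm,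
      ← lintegral_const_mul' _ _ ofReal_ne_top]
    refine le_trans ?_ ((setLIntegral_le_lintegral K _).trans hM)
    refine lintegral_mono_ae ?_
    filter_upwards [hLp.coeFn_toLp, ae_restrict_mem hK.measurableSet] with x hx hxK
    rw [hx]
    by_cases h : ‖G x‖ < r
    · simp [hτ, h]
    · simp only [hτ, if_neg h, sub_zero]
      rw [← ofReal_norm, ← ofReal_mul hC.le]
      exact hr x hxK _ (not_lt.1 h)

theorem exists_subseq_tendsto_of_cauchy_lintegral {n : ℕ} {F : Type*} [NormedAddCommGroup F]
    [CompleteSpace F] {G : ℕ → En n → F} (hG : ∀ l, AEStronglyMeasurable (G l) volume)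
    (hcau : ∀ R : ℕ, ∀ ε : ℝ≥0∞, 0 < ε → ∃ N, ∀ i ≥ N, ∀ k ≥ N,
      ∫⁻ x in Metric.closedBall 0 (R : ℝ), ‖G i x - G k x‖ₑ < ε) :
    ∃ φ : ℕ → ℕ, StrictMono φ ∧ ∃ D : En n → F, AEStronglyMeasurable D volume ∧
      (∀ᵐ x, Tendsto (fun l => G (φ l) x) atTop (𝓝 (D x))) ∧
      ∀ R : ℕ, Tendsto (fun l => ∫⁻ x in Metric.closedBall 0 (R : ℝ), ‖G (φ l) x - D x‖ₑ)
        atTop (𝓝 0) := by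
  have hpow : ∀ l : ℕ, (0 : ℝ≥0∞) < 2⁻¹ ^ l := fun l => ENNReal.pow_pos (by simp) l
  obtain ⟨φ, hφ, hφP⟩ := extraction_forall_of_eventually
    (P := fun l N => ∀ i ≥ N, ∀ k ≥ N,
      ∫⁻ x in Metric.closedBall 0 (l : ℝ), ‖G i x - G k x‖ₑ < 2⁻¹ ^ l) fun l => by
    obtain ⟨N, hN⟩ := hcau l _ (hpow l)
    filter_upwards [eventually_ge_atTop N] with M hM i hi k hk
    exact hN i (hM.trans hi) k (hM.trans hk)
  have hfast : ∀ R l i k : ℕ, R ≤ l → l ≤ i → l ≤ k →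
      ∫⁻ x in Metric.closedBall 0 (R : ℝ), ‖G (φ i) x - G (φ k) x‖ₑ < 2⁻¹ ^ l :=
    fun R l i k hRl hi hk => (lintegral_mono_set (Metric.closedBall_subset_closedBall
      (Nat.cast_le.2 hRl))).trans_lt (hφP l _ (hφ.monotone hi) _ (hφ.monotone hk))
  have hex : ∀ R : ℕ, ∀ᵐ x ∂volume.restrict (Metric.closedBall (0 : En n) (R : ℝ)),
      ∃ y, Tendsto (fun l => G (φ l) x) atTop (𝓝 y) := by
    intro R
    have h := Lp.ae_tendsto_of_cauchy_eLpNorm (p := 1) (f := fun l => G (φ (l + R)))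
      (μ := volume.restrict (Metric.closedBall (0 : En n) (R : ℝ))) (B := fun l => 2⁻¹ ^ l)
      (fun l => (hG _).restrict) le_rfl (by rw [ENNReal.tsum_geometric]; simp) ?_
    · filter_upwards [h] with x ⟨y, hy⟩
      exact ⟨y, (tendsto_add_atTop_iff_nat (f := fun l => G (φ l) x) R).1 hy⟩
    · intro N i k hi hk
      rw [eLpNorm_one_eq_lintegral_enorm]
      refine (hfast R (N + R) (i + R) (k + R) (by omega) (by omega) (by omega)).trans_le ?_
      exact pow_le_pow_right_of_le_one' (by simp) (by omega)
  have hex' : ∀ᵐ x ∂(volume : Measure (En n)),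
      ∃ y, Tendsto (fun l => G (φ l) x) atTop (𝓝 y) := by
    have h : ∀ᵐ x ∂(volume : Measure (En n)), ∀ R : ℕ, x ∈ Metric.closedBall (0 : En n) (R : ℝ) →
        ∃ y, Tendsto (fun l => G (φ l) x) atTop (𝓝 y) :=
      ae_all_iff.2 fun R =>
        (ae_restrict_iff' Metric.isClosed_closedBall.measurableSet).1 (hex R)
    filter_upwards [h] with x hx
    obtain ⟨R, hR⟩ := exists_nat_ge ‖x‖
    exact hx R (by simpa using hR)
  have hlim : ∀ᵐ x ∂(volume : Measure (En n)),
      Tendsto (fun l => G (φ l) x) atTop (𝓝 (limUnder atTop fun l => G (φ l) x)) := by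
    filter_upwards [hex'] with x hx
    exact tendsto_nhds_limUnder hx
  have hDm : AEStronglyMeasurable (fun x => limUnder atTop fun l => G (φ l) x) volume :=
    aestronglyMeasurable_of_tendsto_ae atTop (fun l => hG (φ l)) hlim
  refine ⟨φ, hφ, _, hDm, hlim, fun R => ?_⟩
  refine tendsto_of_tendsto_of_tendsto_of_le_of_le' tendsto_const_nhds
    (h := fun l : ℕ => (2⁻¹ : ℝ≥0∞) ^ l)
    (ENNReal.tendsto_pow_atTop_nhds_zero_of_lt_one (by simp))
    (Eventually.of_forall fun _ => zero_le) ?_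
  filter_upwards [eventually_ge_atTop R] with l hl
  calc ∫⁻ x in Metric.closedBall 0 (R : ℝ), ‖G (φ l) x - limUnder atTop fun l => G (φ l) x‖ₑ
      ≤ ∫⁻ x in Metric.closedBall 0 (R : ℝ),
          liminf (fun k => ‖G (φ l) x - G (φ k) x‖ₑ) atTop := by
        refine lintegral_mono_ae ?_
        filter_upwards [ae_restrict_of_ae hlim] with x hx
        exact (hx.const_sub (G (φ l) x)).enorm.liminf_eq.ge
    _ ≤ liminf (fun k => ∫⁻ x in Metric.closedBall 0 (R : ℝ), ‖G (φ l) x - G (φ k) x‖ₑ)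
          atTop :=
        lintegral_liminf_le' fun k => ((hG _).restrict.sub (hG _).restrict).enorm
    _ ≤ 2⁻¹ ^ l := by
        refine liminf_le_of_frequently_le' (Eventually.frequently ?_)
        filter_upwards [eventually_ge_atTop l] with k hk
        exact (hfast R l l k hl le_rfl hk).le

/-- Triples consisting of a function, its weak gradient, and square-integrable approximations of
the gradient on balls, with energy almost `ℓ` and the function almost `u`. -/
def approximants {n : ℕ} (Ψ : En n → En n → ℝ≥0∞) (u : En n → ℝ) (ℓ : ℝ≥0∞) (b : ℕ → ℝ)
    (j : ℕ) : Set ((En n → ℝ) × (En n → En n) ×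
      (∀ m : ℕ, Lp (En n) 2 (volume.restrict (Metric.closedBall (0 : En n) (m : ℝ))))) :=
  {p | HasWeakGradient p.1 p.2.1 ∧
    ∫⁻ x in Metric.closedBall 0 (j : ℝ), ‖p.1 x - u x‖ₑ ≤ ((j : ℝ≥0∞) + 1)⁻¹ ∧
    ∫⁻ x, Ψ x (p.2.1 x) ≤ ℓ + ((j : ℝ≥0∞) + 1)⁻¹ ∧
    ∀ m : ℕ, ‖p.2.2 m‖ ≤ b m ∧
      ∫⁻ x in Metric.closedBall 0 (m : ℝ), ‖p.2.1 x - p.2.2 m x‖ₑ ≤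
        (ℓ + 1) / ENNReal.ofReal ((m : ℝ) + 1)}

theorem antitone_approximants {n : ℕ} (Ψ : En n → En n → ℝ≥0∞) (u : En n → ℝ) (ℓ : ℝ≥0∞)
    (b : ℕ → ℝ) : Antitone (approximants Ψ u ℓ b) := by
  intro i j hij p hp
  obtain ⟨h1, h2, h3, h4⟩ := hp
  have hinv : ((j : ℝ≥0∞) + 1)⁻¹ ≤ ((i : ℝ≥0∞) + 1)⁻¹ := by gcongr
  exact ⟨h1, (lintegral_mono_set (Metric.closedBall_subset_closedBall
    (Nat.cast_le.2 hij))).trans (h2.trans hinv), h3.trans (by gcongr), h4⟩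

theorem convex_approximants {n : ℕ} {Ψ : En n → En n → ℝ≥0∞}
    (hΨmeas : Measurable (Function.uncurry Ψ))
    (hconv : ∀ (y : En n) (ξ η : En n) (a b : ℝ), 0 ≤ a → 0 ≤ b → a + b = 1 →
      Ψ y (a • ξ + b • η) ≤ ENNReal.ofReal a * Ψ y ξ + ENNReal.ofReal b * Ψ y η)
    {u : En n → ℝ} (hu : AEStronglyMeasurable u volume) (ℓ : ℝ≥0∞) (b : ℕ → ℝ) (j : ℕ) :
    Convex ℝ (approximants Ψ u ℓ b j) := by
  rintro ⟨w₁, G₁, T₁⟩ ⟨g₁, l₁, e₁, t₁⟩ ⟨w₂, G₂, T₂⟩ ⟨g₂, l₂, e₂, t₂⟩ α β hα hβ hαβ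
  refine ⟨g₁.convex_combination g₂ α β, ?_, ?_, fun m => ⟨?_, ?_⟩⟩
  · refine lintegral_le_of_ae_le_convex_combination hα hβ hαβ
      ((g₁.1.aestronglyMeasurable.sub hu).restrict.enorm) (Eventually.of_forall fun x => ?_) l₁ l₂
    have h := enorm_convex_combination_sub_le hα hβ (w₁ x) (w₂ x) (u x) (u x)
    rwa [← add_smul, hαβ, one_smul] at h
  · exact lintegral_le_of_ae_le_convex_combination hα hβ hαβ
      (hΨmeas.comp_aemeasurable (aemeasurable_id.prodMk g₁.2.1.aestronglyMeasurable.aemeasurable))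
      (Eventually.of_forall fun x => hconv _ _ _ _ _ hα hβ hαβ) e₁ e₂
  · exact mem_closedBall_zero_iff.1 (convex_closedBall (0 : Lp (En n) 2 _) (b m)
      (mem_closedBall_zero_iff.2 (t₁ m).1) (mem_closedBall_zero_iff.2 (t₂ m).1) hα hβ hαβ)
  · refine lintegral_le_of_ae_le_convex_combination hα hβ hαβ
      (g₁.2.1.aestronglyMeasurable.restrict.sub (Lp.aestronglyMeasurable (T₁ m))).enorm ?_
      (t₁ m).2 (t₂ m).2
    filter_upwards [Lp.coeFn_add (α • T₁ m) (β • T₂ m), Lp.coeFn_smul α (T₁ m),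
      Lp.coeFn_smul β (T₂ m)] with x h1 h2 h3
    have h := enorm_convex_combination_sub_le hα hβ (G₁ x) (G₂ x) (T₁ m x) (T₂ m x)
    refine le_trans (le_of_eq ?_) h
    congr 2
    refine h1.trans ?_
    simp only [Pi.add_apply, h2, h3, Pi.smul_apply]

theorem cauchy_lintegral_of_cauchySeq_approximation {n : ℕ} {G : ℕ → En n → En n}
    (hG : ∀ j, AEStronglyMeasurable (G j) volume)
    {T : ℕ → ∀ m : ℕ, Lp (En n) 2 (volume.restrict (Metric.closedBall (0 : En n) (m : ℝ)))}
    (hT : ∀ m, CauchySeq fun j => T j m) {M : ℝ≥0∞} (hM : M ≠ ⊤)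
    (hGT : ∀ j m : ℕ, ∫⁻ x in Metric.closedBall 0 (m : ℝ), ‖G j x - T j m x‖ₑ ≤
      M / ENNReal.ofReal ((m : ℝ) + 1))
    (R : ℕ) (ε : ℝ≥0∞) (hε : 0 < ε) :
    ∃ N, ∀ i ≥ N, ∀ k ≥ N, ∫⁻ x in Metric.closedBall 0 (R : ℝ), ‖G i x - G k x‖ₑ < ε := by
  have hlim : Tendsto (fun m : ℕ => M / ENNReal.ofReal ((m : ℝ) + 1)) atTop (𝓝 0) := by
    have h : Tendsto (fun m : ℕ => ENNReal.ofReal ((m : ℝ) + 1)) atTop (𝓝 ⊤) :=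
      tendsto_ofReal_nhds_top.2 (tendsto_natCast_atTop_atTop.atTop_add tendsto_const_nhds)
    simpa using ENNReal.Tendsto.const_div h (Or.inr hM)
  have hε3 : 0 < ε / 3 := ENNReal.div_pos hε.ne' (by simp)
  obtain ⟨m, hmε, hRm⟩ := ((hlim.eventually_lt_const hε3).and (eventually_ge_atTop R)).exists
  set μ := volume.restrict (Metric.closedBall (0 : En n) (m : ℝ)) with hμ
  have : IsFiniteMeasure μ := ⟨by simpa [hμ] using measure_closedBall_lt_top⟩
  set κ : ℝ≥0∞ := μ univ ^ (1 / (1 : ℝ≥0∞).toReal - 1 / (2 : ℝ≥0∞).toReal) with hκ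
  have hκtop : κ ≠ ⊤ := ENNReal.rpow_ne_top_of_nonneg (by norm_num) (measure_ne_top _ _)
  have hδ : 0 < ε / 3 / κ := ENNReal.div_pos hε3.ne' hκtop
  obtain ⟨N, hN⟩ := EMetric.cauchySeq_iff.1 (hT m) _ hδ
  refine ⟨N, fun i hi k hk => ?_⟩
  have hTT : ∫⁻ x, ‖T i m x - T k m x‖ₑ ∂μ < ε / 3 := by
    have h1 := eLpNorm_le_eLpNorm_mul_rpow_measure_univ (p := 1) (q := 2) (μ := μ)
      (f := ⇑(T i m) - ⇑(T k m)) (by norm_num)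
      ((Lp.aestronglyMeasurable (T i m)).sub (Lp.aestronglyMeasurable (T k m)))
    rw [eLpNorm_one_eq_lintegral_enorm, ← Lp.edist_def] at h1
    exact h1.trans_lt (ENNReal.mul_lt_of_lt_div (hN i hi k hk))
  have hmi := (hGT i m).trans_lt hmε
  have hmk := (hGT k m).trans_lt hmε
  have hA : ∀ j, AEMeasurable (fun x => ‖G j x - T j m x‖ₑ) μ := fun j =>
    ((hG j).restrict.sub (Lp.aestronglyMeasurable (T j m))).enorm
  calc ∫⁻ x in Metric.closedBall 0 (R : ℝ), ‖G i x - G k x‖ₑ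
      ≤ ∫⁻ x, ‖G i x - G k x‖ₑ ∂μ := lintegral_mono_set
        (Metric.closedBall_subset_closedBall (Nat.cast_le.2 hRm))
    _ ≤ ∫⁻ x, (‖G i x - T i m x‖ₑ + ‖T i m x - T k m x‖ₑ + ‖G k x - T k m x‖ₑ) ∂μ := by
        refine lintegral_mono fun x => ?_
        rw [show G i x - G k x = (G i x - T i m x) + (T i m x - T k m x) - (G k x - T k m x) by
          abel]
        exact (enorm_sub_le).trans (by gcongr; exact enorm_add_le _ _)
    _ = ∫⁻ x, ‖G i x - T i m x‖ₑ ∂μ + ∫⁻ x, ‖T i m x - T k m x‖ₑ ∂μ +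
          ∫⁻ x, ‖G k x - T k m x‖ₑ ∂μ := by
        rw [lintegral_add_right' _ (hA k), lintegral_add_left' (hA i)]
    _ < ε / 3 + ε / 3 + ε / 3 := ENNReal.add_lt_add (ENNReal.add_lt_add hmi hTT) hmk
    _ = ε := ENNReal.add_thirds ε

theorem HasWeakGradient.of_tendsto_s8 {n : ℕ} {w : ℕ → En n → ℝ} {G : ℕ → En n → En n}
    {u : En n → ℝ} {D : En n → En n} (hwG : ∀ l, HasWeakGradient (w l) (G l))
    (hu : AEStronglyMeasurable u volume) (hD : AEStronglyMeasurable D volume)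
    (hw : ∀ R : ℕ, Tendsto (fun l => ∫⁻ x in Metric.closedBall 0 (R : ℝ), ‖w l x - u x‖ₑ)
      atTop (𝓝 0))
    (hG : ∀ R : ℕ, Tendsto (fun l => ∫⁻ x in Metric.closedBall 0 (R : ℝ), ‖G l x - D x‖ₑ)
      atTop (𝓝 0)) :
    HasWeakGradient u D := by
  have huL : LocallyIntegrable u volume :=
    locallyIntegrable_of_lintegral_sub_lt_top hu (fun l => (hwG l).1)
      fun R => ((hw R).eventually_lt_const zero_lt_top).exists
  have hDL : LocallyIntegrable D volume :=
    locallyIntegrable_of_lintegral_sub_lt_top hD (fun l => (hwG l).2.1)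
      fun R => ((hG R).eventually_lt_const zero_lt_top).exists
  refine ⟨huL, hDL, fun φ hφ hφc i => ?_⟩
  have hcoord : ∀ {F : En n → En n}, LocallyIntegrable F volume →
      LocallyIntegrable (fun x => F x i) volume := fun {F} hF x => by
    obtain ⟨s, hs, hFs⟩ := hF x
    exact ⟨s, hs, (EuclideanSpace.proj (𝕜 := ℝ) i).integrable_comp hFs⟩
  have h1 := tendsto_integral_mul_of_tendsto_lintegral_sub huL (fun l => (hwG l).1) hw
    (φ := fun x => fderiv ℝ φ x (EuclideanSpace.single i 1))
    ((hφ.continuous_fderiv (by simp)).clm_apply continuous_const)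
    (hφc.fderiv_apply (𝕜 := ℝ) _)
  have h2 := tendsto_integral_mul_of_tendsto_lintegral_sub (g := fun l x => G l x i)
    (hcoord hDL) (fun l => hcoord (hwG l).2.1) (fun R => by
      refine tendsto_of_tendsto_of_tendsto_of_le_of_le tendsto_const_nhds (hG R)
        (fun _ => zero_le) fun l => lintegral_mono fun x => ?_
      rw [← PiLp.sub_apply]
      exact PiLp.enorm_apply_le _ _) hφ.continuous hφc
  simp only [(hwG _).2.2 φ hφ hφc i] at h1
  exact tendsto_nhds_unique h1 h2.neg

/-- lower semicontinuity lemma. -/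
theorem statement8 {n : ℕ} (Ψ : En n → En n → ℝ≥0∞)
    (hΨmeas : Measurable (Function.uncurry Ψ)) (hΨ0 : ∀ y, Ψ y 0 = 0)
    (hcoercive : LocallyCoercive Ψ)
    (hconv : ∀ (y : En n) (ξ η : En n) (a b : ℝ), 0 ≤ a → 0 ≤ b → a + b = 1 →
      Ψ y (a • ξ + b • η) ≤ ENNReal.ofReal a * Ψ y ξ + ENNReal.ofReal b * Ψ y η)
    (hlsc : ∀ y : En n, LowerSemicontinuous (Ψ y))
    (v : ℕ → En n → ℝ) (Dv : ℕ → En n → En n)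
    (hv : ∀ k, HasWeakGradient (v k) (Dv k))
    (vlim : En n → ℝ) (hvm : AEStronglyMeasurable vlim volume)
    (hconvL1 : ∀ K : Set (En n), IsCompact K →
      Tendsto (fun k => ∫⁻ x in K, ENNReal.ofReal |v k x - vlim x|) atTop (nhds 0))
    (hliminf : liminf (fun k => ∫⁻ y, Ψ y (Dv k y)) atTop < ⊤) :
    ∃ D : En n → En n, HasWeakGradient vlim D ∧
      ∫⁻ y, Ψ y (D y) ≤ liminf (fun k => ∫⁻ y, Ψ y (Dv k y)) atTop := by
  set ℓ := liminf (fun k => ∫⁻ y, Ψ y (Dv k y)) atTop with hℓ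
  choose r hr using fun m : ℕ => hcoercive (Metric.closedBall 0 (m : ℝ))
    (isCompact_closedBall _ _) ((m : ℝ) + 1)
  set b : ℕ → ℝ := fun m => (volume.restrict (Metric.closedBall (0 : En n) (m : ℝ))).real univ ^
    (2 : ℝ≥0∞).toReal⁻¹ * max (r m) 0 with hb
  have hne : ∀ j, (approximants Ψ vlim ℓ b j).Nonempty := by
    intro j
    have hpos : (0 : ℝ≥0∞) < ((j : ℝ≥0∞) + 1)⁻¹ :=
      ENNReal.inv_pos.2 (by exact_mod_cast natCast_ne_top (j + 1))
    have hfreq := frequently_lt_of_liminf_lt (u := fun k => ∫⁻ y, Ψ y (Dv k y)) (f := atTop)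
      (b := ℓ + ((j : ℝ≥0∞) + 1)⁻¹) (h := ENNReal.lt_add_right hliminf.ne hpos.ne')
    obtain ⟨k, hk, hk'⟩ := (hfreq.and_eventually
      ((hconvL1 _ (isCompact_closedBall (0 : En n) (j : ℝ))).eventually_lt_const hpos)).exists
    have hle : ∫⁻ y, Ψ y (Dv k y) ≤ ℓ + 1 :=
      hk.le.trans (by gcongr; exact ENNReal.inv_le_one.2 le_add_self)
    choose T hTb hT using fun m : ℕ => exists_lp_norm_le_and_lintegral_sub_le
      (isCompact_closedBall (0 : En n) (m : ℝ)) (by positivity) (hr m)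
      (hv k).2.1.aestronglyMeasurable hle
    refine ⟨(v k, Dv k, T), hv k, ?_, hk.le, fun m => ⟨hTb m, hT m⟩⟩
    simpa only [Real.enorm_eq_ofReal_abs] using hk'.le
  obtain ⟨y, hy, hyT⟩ := exists_mem_forall_cauchySeq_of_convex
    (fun m => LinearMap.proj m ∘ₗ LinearMap.snd ℝ _ _ ∘ₗ LinearMap.snd ℝ (En n → ℝ) _) b
    (approximants Ψ vlim ℓ b) (antitone_approximants Ψ vlim ℓ b)
    (convex_approximants hΨmeas hconv hvm ℓ b) hne fun p hp m => (hp.2.2.2 m).1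
  have hGm : ∀ j, AEStronglyMeasurable (y j).2.1 volume :=
    fun j => (hy j).1.2.1.aestronglyMeasurable
  obtain ⟨φ, hφ, D, hDm, hae, hL1⟩ := exists_subseq_tendsto_of_cauchy_lintegral hGm
    (cauchy_lintegral_of_cauchySeq_approximation hGm (T := fun j => (y j).2.2) hyT
      (M := ℓ + 1) (by simpa using hliminf.ne) fun j m => ((hy j).2.2.2 m).2)
  have hyφ : ∀ l, y (φ l) ∈ approximants Ψ vlim ℓ b l := fun l =>
    antitone_approximants Ψ vlim ℓ b hφ.le_apply (hy _)
  have hinv : Tendsto (fun l : ℕ => ((l : ℝ≥0∞) + 1)⁻¹) atTop (𝓝 0) := by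
    simpa using (tendsto_add_atTop_iff_nat 1).2 ENNReal.tendsto_inv_nat_nhds_zero
  refine ⟨D, HasWeakGradient.of_tendsto_s8 (fun l => (hyφ l).1) hvm hDm (fun R => ?_) hL1, ?_⟩
  · refine tendsto_of_tendsto_of_tendsto_of_le_of_le' tendsto_const_nhds hinv
      (Eventually.of_forall fun _ => zero_le) ?_
    filter_upwards [eventually_ge_atTop R] with l hl
    exact (lintegral_mono_set (Metric.closedBall_subset_closedBall
      (Nat.cast_le.2 hl))).trans (hyφ l).2.1
  · calc ∫⁻ x, Ψ x (D x)
        ≤ ∫⁻ x, liminf (fun l => Ψ x ((y (φ l)).2.1 x)) atTop := by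
          refine lintegral_mono_ae ?_
          filter_upwards [hae] with x hx
          exact (((hlsc x).lowerSemicontinuousAt (D x)).le_liminf).trans
            hx.liminf_le_liminf_comp
      _ ≤ liminf (fun l => ∫⁻ x, Ψ x ((y (φ l)).2.1 x)) atTop :=
          lintegral_liminf_le' fun l => hΨmeas.comp_aemeasurable
            (aemeasurable_id.prodMk (hGm _).aemeasurable)
      _ ≤ liminf (fun l : ℕ => ℓ + ((l : ℝ≥0∞) + 1)⁻¹) atTop :=
          liminf_le_liminf (Eventually.of_forall fun l => (hyφ l).2.2.1)
      _ = ℓ := by simpa using (hinv.const_add ℓ).liminf_eq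
end
end

section
/- Let M and N be measurable spaces and let ·* be a transformation of measurable subsets of M to measurable subsets of N that induces a transformation of functions acting on level sets. Then for every continuous nondecreasing function f : ℝ̄ → ℝ̄ and every measurable u : M → ℝ̄, one has (f ∘ u)* = f ∘ (u*). -/
open Set Filter Topology

/-- The strict superlevel set of a continuous monotone function on a complete linear order is
everything or an open upper ray. -/
theorem Monotone.preimage_Ioi_eq_univ_or_Ioi {α β : Type*} [CompleteLinearOrder α]
    [TopologicalSpace α] [OrderTopology α] [LinearOrder β] [TopologicalSpace β]
    [OrderClosedTopology β] {f : α → β} (hf : Monotone f) (hc : Continuous f) (t : β) :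
    (∀ s, t < f s) ∨ ∃ a, ∀ s, t < f s ↔ a < s := by
  by_cases h : ∀ s, t < f s
  · exact Or.inl h
  push Not at h
  have hclosed : IsClosed {s | f s ≤ t} := isClosed_le hc continuous_const
  have hmem : f (sSup {s | f s ≤ t}) ≤ t := hclosed.sSup_mem h
  refine Or.inr ⟨sSup {s | f s ≤ t}, fun s => ?_⟩
  constructor
  · intro hs
    by_contra! hle
    exact absurd hs (((hf hle).trans hmem).not_gt)
  · intro hs
    by_contra! hle
    exact absurd hs (le_sSup (s := {s | f s ≤ t}) hle).not_gt

theorem EReal.eq_of_forall_coe_lt_iff {a b : EReal} (h : ∀ t : ℝ, (t : EReal) < a ↔ (t : EReal) < b) :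
    a = b := by
  apply le_antisymm
  · by_contra! hlt
    obtain ⟨t, h₁, h₂⟩ := EReal.lt_iff_exists_real_btwn.1 hlt
    exact absurd ((h t).1 h₂) h₁.not_gt
  · by_contra! hlt
    obtain ⟨t, h₁, h₂⟩ := EReal.lt_iff_exists_real_btwn.1 hlt
    exact absurd ((h t).2 h₂) h₁.not_gt

/-- The level set identity at all real levels implies the one at level `⊥`. -/
theorem setOf_bot_lt_eq_of_level {M N : Type*} [MeasurableSpace M]
    {T : Set M → Set N} {F : (M → EReal) → N → EReal}
    (hlevel : ∀ u : M → EReal, Measurable u → ∀ t : ℝ,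
      {y : N | (t : EReal) < F u y} = T {x : M | (t : EReal) < u x})
    {u : M → EReal} (hu : Measurable u) :
    {y : N | ⊥ < F u y} = T {x : M | ⊥ < u x} := by
  set v : M → EReal := fun x => ((EReal.exp (u x) : ENNReal) : EReal) with hv_def
  have hv : Measurable v := measurable_coe_ennreal_ereal.comp (EReal.measurable_exp.comp hu)
  have hexp (s : ℝ) : {y | ((Real.exp s : ℝ) : EReal) < F v y} = {y | (s : EReal) < F u y} := by
    rw [hlevel v hv, hlevel u hu]
    congr 1
    ext x
    have hs : ((Real.exp s : ℝ) : EReal) = ((EReal.exp s : ENNReal) : EReal) := by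
      rw [EReal.exp_coe, EReal.coe_ennreal_ofReal, max_eq_left (Real.exp_pos s).le]
    simp only [mem_ofPred_eq, hv_def, hs, EReal.coe_ennreal_lt_coe_ennreal_iff,
      EReal.exp_lt_exp_iff]
  have hzero : {y | ((0 : ℝ) : EReal) < F v y} = T {x | ⊥ < u x} := by
    rw [hlevel v hv]
    congr 1
    ext x
    have h0 : ((0 : ℝ) : EReal) = ((EReal.exp ⊥ : ENNReal) : EReal) := by simp
    simp only [mem_ofPred_eq, hv_def, h0, EReal.coe_ennreal_lt_coe_ennreal_iff,
      EReal.exp_lt_exp_iff]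
  rw [← hzero]
  ext y
  constructor
  · intro hy
    obtain ⟨s, -, hs⟩ := EReal.lt_iff_exists_real_btwn.1 hy
    have hmem : y ∈ {y | ((Real.exp s : ℝ) : EReal) < F v y} := (hexp s).symm ▸ hs
    exact (EReal.coe_lt_coe_iff.2 (Real.exp_pos s)).trans hmem
  · intro hy
    obtain ⟨r, hr0, hr⟩ := EReal.lt_iff_exists_real_btwn.1 hy
    rw [EReal.coe_lt_coe_iff] at hr0
    have hmem : y ∈ {y | ((Real.exp (Real.log r) : ℝ) : EReal) < F v y} := by
      rwa [Real.exp_log hr0]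
    rw [hexp] at hmem
    exact (EReal.bot_lt_coe _).trans hmem

/-- A transformation of functions induced by a transformation of sets acting
on level sets commutes with composition with continuous nondecreasing functions. -/
theorem statement13 {M N : Type*} [MeasurableSpace M] [MeasurableSpace N]
    (T : Set M → Set N) (F : (M → EReal) → N → EReal)
    (hTmeas : ∀ A : Set M, MeasurableSet A → MeasurableSet (T A))
    (hempty : T ∅ = ∅) (huniv : T univ = univ)
    (hFmeas : ∀ u : M → EReal, Measurable u → Measurable (F u))
    (hlevel : ∀ u : M → EReal, Measurable u → ∀ t : ℝ,
      {y : N | (t : EReal) < F u y} = T {x : M | (t : EReal) < u x}) :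
    ∀ f : EReal → EReal, Continuous f → Monotone f →
      ∀ u : M → EReal, Measurable u → F (f ∘ u) = f ∘ F u := by
  intro f hc hf u hu
  have hlevel_ext (a : EReal) : {y : N | a < F u y} = T {x : M | a < u x} := by
    induction a with
    | bot => exact setOf_bot_lt_eq_of_level hlevel hu
    | coe t => exact hlevel u hu t
    | top => simp [hempty]
  funext y
  refine EReal.eq_of_forall_coe_lt_iff fun t => ?_
  suffices h : {y | (t : EReal) < F (f ∘ u) y} = {y | (t : EReal) < f (F u y)} from
    Set.ext_iff.1 h y
  rw [hlevel _ (hc.measurable.comp hu)]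
  rcases hf.preimage_Ioi_eq_univ_or_Ioi hc (t : EReal) with h | ⟨a, h⟩
  · simp [h, huniv]
  · simp only [Function.comp_apply, h, hlevel_ext]
end
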